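/- arXiv:1802.03081 — 3 statements merged into one kernel-verified Lean document; each statement's English description precedes it below -/
import Mathlib

section
/- Let n ≥ 2 be an integer and let θ = (θ_1,…,θ_n) ∈ ℝ^n be such that 1, θ_1, …, θ_n are linearly independent over ℚ. Suppose the uniform exponent satisfies λ̂(θ) < 1. Then the ordinary exponent satisfies λ(θ) ≥ λ̂(θ) · G(n, λ̂(θ)), where G(n, λ̂(θ)) is the unique positive real root of R_{n,λ̂(θ)} (the inequality is read in [0,+∞], λ(θ) possibly being +∞). -/
open scoped BigOperators ENNReal

noncomputable section

/-- Distance from a real number to the nearest integer. -/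
def nint (x : ℝ) : ℝ := |x - (round x : ℝ)|

/-- `R_{n,α}(x) = x^(n-1) - (α/(1-α)) * (x^(n-2) + ⋯ + x + 1)`. -/
def Rpoly (n : ℕ) (α : ℝ) (x : ℝ) : ℝ :=
  x ^ (n - 1) - α / (1 - α) * ∑ i ∈ Finset.range (n - 1), x ^ i

/-- Irrationality measure function for simultaneous approximation:
`ψ(t) = min { max_j ‖q θ_j‖ : q ∈ ℤ, 0 < q ≤ t }`. -/
def psi {n : ℕ} (θ : Fin n → ℝ) (t : ℝ) : ℝ :=
  sInf {v : ℝ | ∃ q : ℤ, 0 < q ∧ (q : ℝ) ≤ t ∧ v = ⨆ i : Fin n, nint ((q : ℝ) * θ i)}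

/-- Ordinary exponent of simultaneous Diophantine approximation, in `[0,∞]`. -/
def lambdaOrd {n : ℕ} (θ : Fin n → ℝ) : ℝ≥0∞ :=
  sSup {x : ℝ≥0∞ | ∃ μ : ℝ, 0 ≤ μ ∧ x = ENNReal.ofReal μ ∧
    Filter.liminf (fun t : ℝ => ENNReal.ofReal (t ^ μ * psi θ t)) Filter.atTop < ⊤}

/-- Uniform exponent of simultaneous Diophantine approximation, in `[0,∞]`. -/
def lambdaUnif {n : ℕ} (θ : Fin n → ℝ) : ℝ≥0∞ :=
  sSup {x : ℝ≥0∞ | ∃ μ : ℝ, 0 ≤ μ ∧ x = ENNReal.ofReal μ ∧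
    Filter.limsup (fun t : ℝ => ENNReal.ofReal (t ^ μ * psi θ t)) Filter.atTop < ⊤}

lemma abs_det_le_factorial_mul_prod {n : ℕ} (A : Matrix (Fin n) (Fin n) ℝ) (b : Fin n → ℝ)
    (h : ∀ i j, |A i j| ≤ b i) : |A.det| ≤ n.factorial * ∏ i, b i := by
  rw [← Matrix.det_transpose, Matrix.det_apply]
  refine (Finset.abs_sum_le_sum_abs _ _).trans ?_
  calc ∑ σ : Equiv.Perm (Fin n), |Equiv.Perm.sign σ • ∏ i, A.transpose (σ i) i|
      ≤ ∑ _σ : Equiv.Perm (Fin n), ∏ i, b i := by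
        refine Finset.sum_le_sum fun σ _ => ?_
        have hs : |Equiv.Perm.sign σ • ∏ i, A.transpose (σ i) i|
            = |∏ i, A.transpose (σ i) i| := by
          rcases Int.units_eq_one_or (Equiv.Perm.sign σ) with h | h <;> simp [h]
        rw [hs, Finset.abs_prod]
        exact Finset.prod_le_prod (fun i _ => abs_nonneg _) fun i _ => h i (σ i)
    _ = n.factorial * ∏ i, b i := by
        simp [Finset.sum_const, Finset.card_univ, Fintype.card_perm]

lemma one_le_of_det_ne_zero {n : ℕ} (v : Matrix (Fin (n + 1)) (Fin (n + 1)) ℤ)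
    (hv : v.det ≠ 0) (u : Fin n → Fin (n + 1) → ℝ) (c b : Fin n → ℝ)
    (a : Fin n → Fin (n + 1) → ℝ) (ha : ∀ j k, j.succ ≤ k → a j k = 0)
    (hu : ∀ j i, u j i = ∑ k, a j k * (v k i : ℝ))
    (h0 : ∀ j, (v j.succ 0 : ℝ) = c j * u j 0)
    (hb : ∀ j k, |(v j.succ (Fin.succ k) : ℝ) - c j * u j k.succ| ≤ b j) :
    1 ≤ |(v 0 0 : ℝ)| * (n.factorial * ∏ j, b j) := by
  let V : Matrix (Fin (n + 1)) (Fin (n + 1)) ℝ := v.map (Int.castRingHom ℝ)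
  let U : Matrix (Fin (n + 1)) (Fin (n + 1)) ℝ :=
    Matrix.of (Fin.cons (fun k => if k = 0 then 1 else 0)
      (fun j k => (if k = j.succ then 1 else 0) - c j * a j k))
  have hU : U.det = 1 := by
    rw [Matrix.det_of_isLowerTriangular U]
    · refine Finset.prod_eq_one fun i _ => ?_
      refine Fin.cases ?_ (fun j => ?_) i
      · simp [U]
      · simp [U, ha j j.succ le_rfl]
    · intro i k hik
      have hik : i < k := hik
      revert hik
      refine Fin.cases (fun hik => ?_) (fun j hik => ?_) i
      · simp [U, (Fin.pos_iff_ne_zero.mp hik)]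
      · simp [U, ha j k hik.le, hik.ne']
  have hW0 : ∀ k, (U * V) 0 k = v 0 k := by
    intro k
    simp [Matrix.mul_apply, U, V]
  have hWs : ∀ j k, (U * V) (Fin.succ j) k = v j.succ k - c j * u j k := by
    intro j k
    simp [Matrix.mul_apply, U, V, sub_mul, Finset.sum_sub_distrib, hu, Finset.mul_sum, mul_assoc]
  have hdet : |(U * V).det| = |(v.det : ℝ)| := by
    rw [Matrix.det_mul, hU, one_mul]
    congr 1
    exact (RingHom.map_det (Int.castRingHom ℝ) v).symm
  have h1 : (1 : ℝ) ≤ |(v.det : ℝ)| := by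
    exact_mod_cast Int.one_le_abs hv
  rw [← hdet, Matrix.det_succ_column_zero, Fin.sum_univ_succ] at h1
  have hz : ∀ j : Fin n, (U * V) (Fin.succ j) 0 = 0 := fun j => by rw [hWs, h0, sub_self]
  simp only [hz, hW0, mul_zero, zero_mul, Finset.sum_const_zero, add_zero, Fin.val_zero,
    pow_zero, one_mul, abs_mul] at h1
  refine h1.trans (mul_le_mul_of_nonneg_left ?_ (abs_nonneg _))
  refine abs_det_le_factorial_mul_prod _ b fun j k => ?_
  simpa [Matrix.submatrix_apply, hWs] using hb j k

lemma exists_jump_indices {n : ℕ} (x : ℕ → Fin (n + 1) → ℚ) (l : ℕ) (hl : x l ≠ 0)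
    (hx : ∀ S : Submodule ℚ (Fin (n + 1) → ℚ), S ≠ ⊤ → ∀ k, ∃ t, k < t ∧ x t ∉ S) :
    ∀ d ≤ n, ∃ s : ℕ → ℕ, s 0 = l ∧ (∀ j < d, s j < s (j + 1)) ∧
      LinearIndependent ℚ (fun i : Fin (d + 1) => x (s i)) ∧
      ∀ j < d, x (s (j + 1)) ≠ x (s (j + 1) - 1) ∧ x (s (j + 1) - 1) ∈
        Submodule.span ℚ (Set.range fun i : Fin (j + 1) => x (s i)) := by
  intro d
  induction d with
  | zero =>
    intro _
    refine ⟨fun _ => l, rfl, by simp, ?_, by simp⟩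
    rw [linearIndependent_finSucc']
    exact ⟨linearIndependent_empty_type, by simpa [Fin.init] using hl⟩
  | succ d ih =>
    intro hd
    obtain ⟨s, hs0, hlt, hli, hmem⟩ := ih (by omega)
    set S := Submodule.span ℚ (Set.range fun i : Fin (d + 1) => x (s i)) with hS
    have hST : S ≠ ⊤ := by
      intro h
      have h1 := finrank_range_le_card (R := ℚ) (fun i : Fin (d + 1) => x (s i))
      rw [Set.finrank, ← hS, h, finrank_top] at h1
      simp at h1
      omega
    classical
    have hex := hx S hST (s d)
    obtain ⟨hk1, hk2⟩ := Nat.find_spec hex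
    have hmin : ∀ t, t < Nat.find hex → s d < t → x t ∈ S := by
      intro t ht h1
      by_contra h2
      exact Nat.find_min hex ht ⟨h1, h2⟩
    set k := Nat.find hex
    have hold : ∀ j ≤ d, Function.update s (d + 1) k j = s j := fun j hj =>
      Function.update_of_ne (by omega) _ _
    have hfam : ∀ j ≤ d, (fun i : Fin (j + 1) => x (Function.update s (d + 1) k i))
        = fun i : Fin (j + 1) => x (s i) := by
      intro j hj
      funext i
      rw [hold i (by omega)]
    refine ⟨Function.update s (d + 1) k, ?_, ?_, ?_, ?_⟩
    · rw [hold 0 (by omega), hs0]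
    · intro j hj
      rw [hold j (by omega)]
      rcases Nat.lt_succ_iff_lt_or_eq.mp hj with h | rfl
      · rw [hold _ (by omega)]
        exact hlt j h
      · simpa using hk1
    · rw [linearIndependent_finSucc']
      have hi : Fin.init (fun i : Fin (d + 1 + 1) => x (Function.update s (d + 1) k i))
          = fun i : Fin (d + 1) => x (s i) := hfam d le_rfl
      rw [hi]
      refine ⟨hli, ?_⟩
      simpa using hk2
    · intro j hj
      rw [hfam j (by omega)]
      rcases Nat.lt_succ_iff_lt_or_eq.mp hj with h | rfl
      · rw [hold _ (by omega)]
        exact hmem j h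
      · rw [Function.update_self]
        have hkS : x (k - 1) ∈ S := by
          by_cases h : k - 1 = s j
          · rw [h]
            exact Submodule.subset_span ⟨Fin.last j, rfl⟩
          · exact hmin _ (by omega) (by omega)
        exact ⟨fun h => hk2 (h ▸ hkS), hkS⟩

lemma mul_prod_rpow_div_le {α g q : ℝ} (hα : 0 < α) (hg : 0 < g) {y z : ℕ → ℝ}
    {n : ℕ} (hE : 0 ≤ 1 - α * ∑ i ∈ Finset.range n, g⁻¹ ^ i)
    (hy : ∀ j ≤ n, 1 ≤ y j) (hz : ∀ j ≤ n, 0 < z j) (hq0 : q ≤ z 0)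
    (hyz : ∀ j < n, y j ≤ z (j + 1)) (hzy : ∀ j ≤ n, y j ^ g⁻¹ ≤ z j) :
    ∀ d ≤ n, q * ∏ j ∈ Finset.range (d + 1), y j ^ (1 - α) / z j
      ≤ y d ^ (1 - α * ∑ i ∈ Finset.range (d + 1), g⁻¹ ^ i) := by
  intro d
  induction d with
  | zero =>
    intro _
    have h0 := hz 0 (by omega)
    have h1 : 0 ≤ y 0 ^ (1 - α) := Real.rpow_nonneg (by linarith [hy 0 (by omega)]) _
    simp only [zero_add, Finset.prod_range_one, Finset.sum_range_one, pow_zero, mul_one]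
    rw [mul_div_left_comm]
    exact mul_le_of_le_one_right h1 ((div_le_one h0).mpr hq0)
  | succ d ih =>
    intro hd
    set e := 1 - α * ∑ i ∈ Finset.range (d + 1), g⁻¹ ^ i with he
    have hgi : 0 < g⁻¹ := inv_pos.mpr hg
    have he0 : 0 ≤ e := by
      refine hE.trans ?_
      have : ∑ i ∈ Finset.range (d + 1), g⁻¹ ^ i ≤ ∑ i ∈ Finset.range n, g⁻¹ ^ i :=
        Finset.sum_le_sum_of_subset_of_nonneg (Finset.range_mono hd) fun i _ _ => by positivity
      nlinarith
    have he1 : e - 1 ≤ 0 := by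
      have : 0 ≤ ∑ i ∈ Finset.range (d + 1), g⁻¹ ^ i := Finset.sum_nonneg fun i _ => by positivity
      nlinarith
    have hyd : 0 < y d := by linarith [hy d (by omega)]
    have hyd' : 0 < y (d + 1) := by linarith [hy (d + 1) hd]
    have hzd := hz (d + 1) hd
    have hrec : 1 - α * ∑ i ∈ Finset.range (d + 1 + 1), g⁻¹ ^ i = g⁻¹ * (e - 1) + (1 - α) := by
      rw [geom_sum_succ, he]
      ring
    rw [Finset.prod_range_succ, ← mul_assoc, hrec, Real.rpow_add hyd', Real.rpow_mul hyd'.le]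
    calc _ ≤ y d ^ e * (y (d + 1) ^ (1 - α) / z (d + 1)) := by
          gcongr
          exact ih (by omega)
      _ ≤ z (d + 1) ^ e * (y (d + 1) ^ (1 - α) / z (d + 1)) := by
          gcongr
          exact hyz d (by omega)
      _ = z (d + 1) ^ (e - 1) * y (d + 1) ^ (1 - α) := by
          rw [Real.rpow_sub_one hzd.ne']
          ring
      _ ≤ (y (d + 1) ^ g⁻¹) ^ (e - 1) * y (d + 1) ^ (1 - α) := by
          gcongr 1
          exact Real.rpow_le_rpow_of_nonpos (by positivity) (hzy _ hd) he1

/-- The approximation error `max_j ‖q θ_j‖` of a natural number `q`. -/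
def approxErr {n : ℕ} (θ : Fin n → ℝ) (q : ℕ) : ℝ := ⨆ i : Fin n, nint ((q : ℝ) * θ i)

/-- The smallest denominator in `{1, …, t + 1}` of minimal approximation error. -/
def bestDen {n : ℕ} (θ : Fin n → ℝ) : ℕ → ℕ
  | 0 => 1
  | t + 1 => if approxErr θ (t + 2) < approxErr θ (bestDen θ t) then t + 2 else bestDen θ t

/-- The integer vector `(q, p_1, …, p_n)` with `q = bestDen θ t` and `p_j` nearest to `q θ_j`. -/
def bestVec {n : ℕ} (θ : Fin n → ℝ) (t : ℕ) : Fin (n + 1) → ℤ :=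
  Fin.cons (bestDen θ t : ℤ) fun i => round ((bestDen θ t : ℝ) * θ i)

section BestApproximations

variable {n : ℕ} (θ : Fin n → ℝ)

lemma approxErr_nonneg (q : ℕ) : 0 ≤ approxErr θ q :=
  Real.iSup_nonneg fun _ => abs_nonneg _

lemma nint_le_approxErr (q : ℕ) (i : Fin n) : nint ((q : ℝ) * θ i) ≤ approxErr θ q :=
  le_ciSup (f := fun i : Fin n => nint ((q : ℝ) * θ i)) (Set.finite_range _).bddAbove i

lemma bestDen_pos (t : ℕ) : 0 < bestDen θ t := by
  induction t with
  | zero => simp [bestDen]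
  | succ t ih =>
    rw [bestDen]
    split_ifs <;> omega

lemma bestDen_le (t : ℕ) : bestDen θ t ≤ t + 1 := by
  induction t with
  | zero => simp [bestDen]
  | succ t ih =>
    rw [bestDen]
    split_ifs <;> omega

lemma bestDen_monotone : Monotone (bestDen θ) := by
  refine monotone_nat_of_le_succ fun t => ?_
  have := bestDen_le θ t
  rw [bestDen]
  split_ifs <;> omega

lemma bestDen_succ_of_ne {t : ℕ} (h : bestDen θ (t + 1) ≠ bestDen θ t) :
    bestDen θ (t + 1) = t + 2 := by
  rw [bestDen] at h ⊢
  split_ifs at h ⊢ <;> simp_all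

lemma approxErr_bestDen_succ_le (t : ℕ) :
    approxErr θ (bestDen θ (t + 1)) ≤ approxErr θ (bestDen θ t) := by
  rw [bestDen]
  split_ifs with h
  · exact h.le
  · exact le_rfl

lemma approxErr_bestDen_le (t : ℕ) :
    ∀ q, 0 < q → q ≤ t + 1 → approxErr θ (bestDen θ t) ≤ approxErr θ q := by
  induction t with
  | zero =>
    intro q h1 h2
    obtain rfl : q = 1 := by omega
    exact le_rfl
  | succ t ih =>
    intro q h1 h2
    rcases Nat.lt_or_ge q (t + 2) with h | h
    · exact (approxErr_bestDen_succ_le θ t).trans (ih q h1 (by omega))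
    · obtain rfl : q = t + 2 := by omega
      rw [bestDen]
      split_ifs with h
      · exact le_rfl
      · exact not_lt.mp h

lemma psi_le_approxErr {q : ℕ} (hq : 0 < q) {t : ℝ} (hqt : (q : ℝ) ≤ t) :
    psi θ t ≤ approxErr θ q := by
  refine csInf_le ⟨0, ?_⟩ ⟨q, by exact_mod_cast hq, by simpa using hqt, by simp [approxErr]⟩
  rintro _ ⟨_, _, _, rfl⟩
  exact Real.iSup_nonneg fun _ => abs_nonneg _

lemma approxErr_bestDen_le_psi (t : ℕ) {τ : ℝ} (h1 : 1 ≤ τ) (h2 : τ < t + 2) :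
    approxErr θ (bestDen θ t) ≤ psi θ τ := by
  refine le_csInf ⟨_, 1, one_pos, by simpa using h1, rfl⟩ ?_
  rintro _ ⟨q, hq0, hq, rfl⟩
  lift q to ℕ using hq0.le
  have h3 : (q : ℝ) < ((t + 2 : ℕ) : ℝ) := by
    push_cast at hq ⊢
    linarith
  have h4 : q < t + 2 := by exact_mod_cast h3
  simpa [approxErr] using approxErr_bestDen_le θ t q (by exact_mod_cast hq0) (by omega)

lemma approxErr_bestDen_le_rpow {α T : ℝ} (hup : ∀ t ≥ T, psi θ t ≤ t ^ (-α)) {t : ℕ}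
    (ht : T ≤ t + 1) : approxErr θ (bestDen θ t) ≤ ((t : ℝ) + 2) ^ (-α) := by
  have ht0 : (0 : ℝ) ≤ t := t.cast_nonneg
  have hc : Filter.Tendsto (fun τ : ℝ => τ ^ (-α)) (nhdsWithin ((t : ℝ) + 2) (Set.Iio (t + 2)))
      (nhds (((t : ℝ) + 2) ^ (-α))) :=
    ((Real.continuousAt_rpow_const _ _ (Or.inl (by positivity))).tendsto).mono_left
      nhdsWithin_le_nhds
  refine ge_of_tendsto hc ?_
  have hI : Set.Ioo ((t : ℝ) + 1) (t + 2) ∈ nhdsWithin ((t : ℝ) + 2) (Set.Iio (t + 2)) :=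
    Ioo_mem_nhdsLT (by linarith)
  filter_upwards [hI] with τ hτ
  exact (approxErr_bestDen_le_psi θ t (by linarith [hτ.1]) hτ.2).trans (hup τ (by linarith [hτ.1]))

lemma tendsto_bestDen_atTop {α β T : ℝ} (hα : 0 < α)
    (hup : ∀ t ≥ T, psi θ t ≤ t ^ (-α)) (hlo : ∀ t ≥ T, t ^ (-β) ≤ psi θ t) :
    Filter.Tendsto (bestDen θ) Filter.atTop Filter.atTop := by
  refine Filter.tendsto_atTop.mpr fun N => ?_
  obtain ⟨M, hM⟩ := exists_nat_ge (max T (max N 1))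
  have hMT : T ≤ M := (le_max_left _ _).trans hM
  have hMN : (N : ℝ) ≤ M := (le_max_left _ _).trans ((le_max_right _ _).trans hM)
  have hM1 : (1 : ℝ) ≤ M := (le_max_right _ _).trans ((le_max_right _ _).trans hM)
  have hpos : (0 : ℝ) < (M : ℝ) ^ (-β) := by positivity
  have hlim : Filter.Tendsto (fun t : ℕ => ((t : ℝ) + 2) ^ (-α)) Filter.atTop (nhds 0) :=
    (tendsto_rpow_neg_atTop hα).comp
      (Filter.tendsto_atTop_add_const_right _ _ tendsto_natCast_atTop_atTop)
  filter_upwards [hlim.eventually_lt_const hpos, Filter.eventually_ge_atTop M] with t ht1 ht2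
  by_contra! h
  have hNM : N ≤ M := by exact_mod_cast hMN
  have h1 : psi θ M ≤ approxErr θ (bestDen θ t) :=
    psi_le_approxErr θ (bestDen_pos θ t) (by exact_mod_cast (h.le.trans hNM))
  have ht2' : (M : ℝ) ≤ t := by exact_mod_cast ht2
  have h2 := approxErr_bestDen_le_rpow θ hup (t := t) (by linarith)
  linarith [hlo M hMT]

lemma exists_bestVec_notMem
    (hθ : LinearIndependent ℚ (Fin.cons (1 : ℝ) θ : Fin (n + 1) → ℝ))
    (hQ : Filter.Tendsto (bestDen θ) Filter.atTop Filter.atTop)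
    (S : Submodule ℚ (Fin (n + 1) → ℚ)) (hS : S ≠ ⊤) (k : ℕ) :
    ∃ t, k < t ∧ (fun i => (bestVec θ t i : ℚ)) ∉ S := by
  by_contra! hcon
  obtain ⟨φ, hφ, hφS⟩ := Submodule.exists_le_ker_of_lt_top S hS.lt_top
  set c : Fin (n + 1) → ℚ := fun i => φ fun j => if i = j then 1 else 0 with hc
  have hφc : ∀ v : Fin (n + 1) → ℚ, φ v = ∑ i, v i * c i := fun v => by
    simpa [hc] using LinearMap.pi_apply_eq_sum_univ φ v
  set γ : ℝ := c 0 + ∑ i : Fin n, c i.succ * θ i with hγ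
  have hγ0 : γ ≠ 0 := by
    intro h
    have h1 := (Fintype.linearIndependent_iff.mp hθ) c (by
      rw [Fin.sum_univ_succ]
      simpa [Rat.smul_def, hγ] using h)
    refine hφ (LinearMap.ext fun v => ?_)
    simp [hφc, h1]
  have hbound : ∀ t, k < t → (bestDen θ t : ℝ) * |γ| ≤ ∑ i : Fin n, |(c i.succ : ℝ)| := by
    intro t ht
    have h1 : φ (fun i => (bestVec θ t i : ℚ)) = 0 := hφS (hcon t ht)
    rw [hφc, Fin.sum_univ_succ] at h1
    have h2 : (bestDen θ t : ℝ) * c 0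
        + ∑ i : Fin n, (round ((bestDen θ t : ℝ) * θ i) : ℝ) * c i.succ = 0 := by
      have := congrArg (fun r : ℚ => (r : ℝ)) h1
      simpa [bestVec] using this
    have h3 : (bestDen θ t : ℝ) * γ = ∑ i : Fin n,
        ((bestDen θ t : ℝ) * θ i - round ((bestDen θ t : ℝ) * θ i)) * c i.succ := by
      simp only [sub_mul, Finset.sum_sub_distrib]
      rw [hγ, mul_add, Finset.mul_sum]
      have h4 : ∑ i : Fin n, (bestDen θ t : ℝ) * ((c i.succ : ℝ) * θ i)
          = ∑ i : Fin n, (bestDen θ t : ℝ) * θ i * (c i.succ : ℝ) :=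
        Finset.sum_congr rfl fun i _ => by ring
      linarith
    calc (bestDen θ t : ℝ) * |γ| = |(bestDen θ t : ℝ) * γ| := by rw [abs_mul, Nat.abs_cast]
      _ ≤ ∑ i : Fin n, |(c i.succ : ℝ)| := by
        rw [h3]
        refine (Finset.abs_sum_le_sum_abs _ _).trans (Finset.sum_le_sum fun i _ => ?_)
        rw [abs_mul]
        refine mul_le_of_le_one_left (abs_nonneg _) ?_
        linarith [abs_sub_round ((bestDen θ t : ℝ) * θ i)]
  obtain ⟨N, hN⟩ := exists_nat_gt ((∑ i : Fin n, |(c i.succ : ℝ)|) / |γ|)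
  obtain ⟨t, ht1, ht2⟩ := ((hQ.eventually_ge_atTop N).and (Filter.eventually_gt_atTop k)).exists
  have h1 := (le_div_iff₀ (abs_pos.mpr hγ0)).mpr (hbound t ht2)
  have h2 : (N : ℝ) ≤ bestDen θ t := by exact_mod_cast ht1
  linarith

end BestApproximations

lemma exists_coeff_of_mem_span {V : Type*} [AddCommGroup V] [Module ℚ V] {x : ℕ → V} {u : V}
    {j : ℕ} (h : u ∈ Submodule.span ℚ (Set.range fun i : Fin j => x i)) :
    ∃ f : ℕ → ℚ, (∀ i, j ≤ i → f i = 0) ∧ ∀ N, j ≤ N → u = ∑ i : Fin N, f i • x i := by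
  obtain ⟨c, hc⟩ := (Submodule.mem_span_range_iff_exists_fun ℚ).mp h
  set f : ℕ → ℚ := fun i => if h : i < j then c ⟨i, h⟩ else 0 with hf
  have hf0 : ∀ i, j ≤ i → f i = 0 := fun i hi => dif_neg (not_lt.mpr hi)
  refine ⟨f, hf0, fun N hN => ?_⟩
  rw [Fin.sum_univ_eq_sum_range (fun i => f i • x i),
    ← Finset.sum_subset (Finset.range_mono hN), ← Fin.sum_univ_eq_sum_range (fun i => f i • x i),
    ← hc]
  · exact Finset.sum_congr rfl fun i _ => by simp [hf]
  · intro i _ hi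
    rw [hf0 i (by simpa using hi), zero_smul]

lemma false_of_psi_bounds {m : ℕ} (θ : Fin (m + 1) → ℝ)
    (hθ : LinearIndependent ℚ (Fin.cons (1 : ℝ) θ : Fin (m + 1 + 1) → ℝ))
    {α g T : ℝ} (hα : 0 < α) (hg : 0 < g)
    (hup : ∀ t ≥ T, psi θ t ≤ t ^ (-α)) (hlo : ∀ t ≥ T, t ^ (-(α * g)) ≤ psi θ t)
    (hE : 0 ≤ 1 - α * ∑ i ∈ Finset.range m, g⁻¹ ^ i)
    (hE' : 1 - α * ∑ i ∈ Finset.range (m + 1), g⁻¹ ^ i < 0) : False := by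
  have hQ := tendsto_bestDen_atTop θ hα hup hlo
  set e := 1 - α * ∑ i ∈ Finset.range (m + 1), g⁻¹ ^ i with he
  set M : ℝ := (m + 1).factorial * 2 ^ (m + 1) with hM
  have hQR : Filter.Tendsto (fun t => (bestDen θ t : ℝ)) Filter.atTop Filter.atTop :=
    tendsto_natCast_atTop_atTop.comp hQ
  have hlim : Filter.Tendsto (fun t => M * (bestDen θ t : ℝ) ^ e) Filter.atTop (nhds 0) := by
    have := ((tendsto_rpow_neg_atTop (neg_pos.mpr hE')).comp hQR).const_mul M
    simpa using this
  obtain ⟨l, ⟨hl1, hl2⟩, hl3⟩ := ((hlim.eventually_lt_const one_pos).and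
    (hQR.eventually_ge_atTop T)).and (tendsto_natCast_atTop_atTop.eventually_ge_atTop T) |>.exists
  set x : ℕ → Fin (m + 1 + 1) → ℚ := fun t i => (bestVec θ t i : ℚ) with hx
  have hxl : x l ≠ 0 := fun h => by
    have := congrFun h 0
    simp [hx, bestVec, (bestDen_pos θ l).ne'] at this
  obtain ⟨s, hs0, hslt, hli, hs⟩ := exists_jump_indices x l hxl
    (fun S hS k => exists_bestVec_notMem θ hθ hQ S hS k) (m + 1) le_rfl
  have hsl : ∀ j ≤ m + 1, l ≤ s j := by
    intro j
    induction j with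
    | zero => intro _; exact hs0.ge
    | succ j ih => intro hj; exact (ih (by omega)).trans (hslt j hj).le
  have hpred : ∀ j ≤ m, s (j + 1) - 1 + 1 = s (j + 1) ∧ l ≤ s (j + 1) - 1 := by
    intro j hj
    have h1 := hslt j (by omega)
    have h2 := hsl j (by omega)
    omega
  have hden : ∀ j ≤ m, bestDen θ (s (j + 1)) = s (j + 1) - 1 + 2 := by
    intro j hj
    have h := (hs j (by omega)).1
    rw [← (hpred j hj).1] at h ⊢
    refine bestDen_succ_of_ne θ fun h1 => h ?_
    simp only [hx, bestVec, Nat.add_sub_cancel, h1]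
  have herr : ∀ j ≤ m, approxErr θ (bestDen θ (s (j + 1))) ≤
      approxErr θ (bestDen θ (s (j + 1) - 1)) := by
    intro j hj
    have := approxErr_bestDen_succ_le θ (s (j + 1) - 1)
    rwa [(hpred j hj).1] at this
  set y : ℕ → ℝ := fun j => bestDen θ (s (j + 1)) with hy
  set z : ℕ → ℝ := fun j => bestDen θ (s (j + 1) - 1) with hz
  set L : ℕ → ℝ := fun j => approxErr θ (bestDen θ (s (j + 1) - 1)) with hL
  have hy1 : ∀ j, 1 ≤ y j := fun j => Nat.one_le_cast.mpr (bestDen_pos θ _)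
  have hz0 : ∀ j, 0 < z j := fun j => Nat.cast_pos.mpr (bestDen_pos θ _)
  have hzy0 : ∀ j, z j ≤ y j := fun j =>
    Nat.cast_le.mpr (bestDen_monotone θ (Nat.sub_le _ _))
  have hLup : ∀ j ≤ m, L j ≤ y j ^ (-α) := by
    intro j hj
    have h1 : (l : ℝ) ≤ ((s (j + 1) - 1 : ℕ) : ℝ) := by exact_mod_cast (hpred j hj).2
    have h2 := approxErr_bestDen_le_rpow θ hup (t := s (j + 1) - 1) (by linarith)
    simp only [hL, hy, hden j hj]
    exact_mod_cast h2
  have hlz : ∀ j ≤ m, (bestDen θ l : ℝ) ≤ z j := fun j hj =>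
    Nat.cast_le.mpr (bestDen_monotone θ (hpred j hj).2)
  have hLlo : ∀ j ≤ m, z j ^ (-(α * g)) ≤ L j := fun j hj =>
    (hlo _ (hl2.trans (hlz j hj))).trans (psi_le_approxErr θ (bestDen_pos θ _) le_rfl)
  have hzy : ∀ j ≤ m, y j ^ g⁻¹ ≤ z j := by
    intro j hj
    have hyp : 0 < y j := by linarith [hy1 j]
    have h1 := (hLlo j hj).trans (hLup j hj)
    rw [Real.rpow_neg (hz0 j).le, Real.rpow_neg hyp.le,
      inv_le_inv₀ (Real.rpow_pos_of_pos (hz0 j) _) (Real.rpow_pos_of_pos hyp _)] at h1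
    refine (Real.rpow_le_rpow_iff (by positivity) (hz0 j).le (mul_pos hα hg)).mp ?_
    rwa [← Real.rpow_mul hyp.le, show g⁻¹ * (α * g) = α by field_simp]
  have hyz : ∀ j < m, y j ≤ z (j + 1) := by
    intro j hj
    have := hslt (j + 1) (by omega)
    exact Nat.cast_le.mpr (bestDen_monotone θ (by omega))
  have hprod := mul_prod_rpow_div_le hα hg hE (fun j _ => hy1 j) (fun j _ => hz0 j)
    (hlz 0 (by omega)) hyz hzy m le_rfl
  have hcoef : ∀ j : Fin (m + 1), ∃ f : ℕ → ℚ, (∀ i, (j : ℕ) + 1 ≤ i → f i = 0) ∧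
      ∀ N, (j : ℕ) + 1 ≤ N → x (s (j + 1) - 1) = ∑ i : Fin N, f i • x (s i) := fun j =>
    exists_coeff_of_mem_span (x := x ∘ s) (hs j j.2).2
  choose f hf0 hf using hcoef
  set v : Matrix (Fin (m + 1 + 1)) (Fin (m + 1 + 1)) ℤ :=
    Matrix.of fun i => bestVec θ (s i) with hv
  have hvdet : v.det ≠ 0 := by
    have h1 : LinearIndependent ℚ (v.map (Int.castRingHom ℚ)).row := hli
    rw [Matrix.linearIndependent_rows_iff_isUnit, Matrix.isUnit_iff_isUnit_det] at h1
    intro h0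
    have h2 := RingHom.map_det (Int.castRingHom ℚ) v
    rw [h0, map_zero] at h2
    exact h1.ne_zero h2.symm
  have key := one_le_of_det_ne_zero v hvdet
    (fun j i => (bestVec θ (s (j + 1) - 1) i : ℝ)) (fun j => y j / z j)
    (fun j => 2 * (y j / z j * L j)) (fun j k => (f j k : ℝ))
    (by
      intro j k hjk
      have h1 : (j : ℕ) + 1 ≤ k := by simpa using Fin.le_def.mp hjk
      simp [hf0 j k h1])
    (by
      intro j i
      have h1 := congrFun (hf j (m + 1 + 1) (by omega)) i
      have h2 := congrArg (fun r : ℚ => (r : ℝ)) h1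
      simpa [hx, hv, Finset.sum_apply] using h2)
    (by
      intro j
      have : (z j) ≠ 0 := (hz0 j).ne'
      simp only [hv, Matrix.of_apply, bestVec, Fin.cons_zero, Fin.val_succ, Int.cast_natCast]
      rw [div_mul_cancel₀ _ this])
    (by
      intro j k
      have hj : (j : ℕ) ≤ m := by omega
      have h1 := (nint_le_approxErr θ _ k).trans (herr j hj)
      have h2 := nint_le_approxErr θ (bestDen θ (s (j + 1) - 1)) k
      have hr : 1 ≤ y j / z j := (one_le_div (hz0 j)).mpr (hzy0 j)
      have hL0 : 0 ≤ L j := approxErr_nonneg θ _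
      simp only [hv, Matrix.of_apply, bestVec, Fin.cons_succ, Fin.val_succ]
      change |y j * θ k - round (y j * θ k)| ≤ L j at h1
      change |z j * θ k - round (z j * θ k)| ≤ L j at h2
      change |(round (y j * θ k) : ℝ) - y j / z j * round (z j * θ k)| ≤ _
      have h3 : (round (y j * θ k) : ℝ) - y j / z j * round (z j * θ k)
          = y j / z j * (z j * θ k - round (z j * θ k)) - (y j * θ k - round (y j * θ k)) := by
        have := (hz0 j).ne'
        field_simp
        ring
      rw [h3]
      refine (abs_sub _ _).trans ?_
      rw [abs_mul, abs_of_nonneg (by linarith : 0 ≤ y j / z j)]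
      nlinarith [mul_le_mul_of_nonneg_left h2 (by linarith : 0 ≤ y j / z j)])
  have hv0 : |(v 0 0 : ℝ)| = bestDen θ l := by
    simp [hv, bestVec, hs0]
  rw [hv0, Fin.prod_univ_eq_prod_range (fun j => 2 * (y j / z j * L j)),
    Finset.prod_mul_distrib, Finset.prod_const, Finset.card_range] at key
  have hLprod : ∏ j ∈ Finset.range (m + 1), (y j / z j * L j)
      ≤ ∏ j ∈ Finset.range (m + 1), y j ^ (1 - α) / z j := by
    refine Finset.prod_le_prod (fun j _ => ?_) fun j hj => ?_
    · have := hz0 j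
      have := hy1 j
      have : 0 ≤ L j := approxErr_nonneg θ _
      positivity
    · have hj : j ≤ m := by simpa [Nat.lt_succ_iff] using hj
      have hyp : 0 < y j := by linarith [hy1 j]
      rw [sub_eq_add_neg, Real.rpow_add hyp, Real.rpow_one, mul_div_right_comm]
      exact mul_le_mul_of_nonneg_left (hLup j hj) (div_pos hyp (hz0 j)).le
  have hlast : y m ^ e ≤ (bestDen θ l : ℝ) ^ e :=
    Real.rpow_le_rpow_of_nonpos (by exact_mod_cast bestDen_pos θ l)
      ((hlz m le_rfl).trans (hzy0 m)) hE'.le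
  have hM0 : 0 ≤ M := by positivity
  have : (1 : ℝ) ≤ M * (bestDen θ l : ℝ) ^ e := by
    calc (1 : ℝ) ≤ _ := key
      _ = M * ((bestDen θ l : ℝ) * ∏ j ∈ Finset.range (m + 1), (y j / z j * L j)) := by
        rw [hM]; ring
      _ ≤ M * ((bestDen θ l : ℝ) * ∏ j ∈ Finset.range (m + 1), y j ^ (1 - α) / z j) := by
        gcongr
      _ ≤ M * (bestDen θ l : ℝ) ^ e := by
        gcongr
        exact hprod.trans hlast
  linarith

lemma eventually_psi_le_rpow {n : ℕ} {θ : Fin n → ℝ} {α : ℝ}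
    (h : ENNReal.ofReal α < lambdaUnif θ) :
    ∀ᶠ t in Filter.atTop, psi θ t ≤ t ^ (-α) := by
  obtain ⟨_, ⟨μ, _, rfl, hμ⟩, hαμ⟩ := lt_sSup_iff.mp h
  have hαμ : α < μ := (ENNReal.ofReal_lt_ofReal_iff').mp hαμ |>.1
  obtain ⟨C, hC1, hC2⟩ := exists_between hμ
  have hlim : Filter.Tendsto (fun t : ℝ => C.toReal * t ^ (-(μ - α))) Filter.atTop (nhds 0) := by
    simpa using (tendsto_rpow_neg_atTop (sub_pos.mpr hαμ)).const_mul C.toReal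
  filter_upwards [Filter.eventually_lt_of_limsup_lt hC1, hlim.eventually_le_const one_pos,
    Filter.eventually_gt_atTop 0] with t h1 h2 h3
  have h4 : t ^ μ * psi θ t ≤ C.toReal := (ENNReal.ofReal_le_iff_le_toReal hC2.ne).mp h1.le
  have hp : 0 < t ^ μ := Real.rpow_pos_of_pos h3 _
  calc psi θ t = t ^ (-μ) * (t ^ μ * psi θ t) := by
        rw [Real.rpow_neg h3.le, inv_mul_cancel_left₀ hp.ne']
    _ ≤ t ^ (-μ) * C.toReal := by gcongr
    _ = (C.toReal * t ^ (-(μ - α))) * t ^ (-α) := by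
        rw [mul_assoc, ← Real.rpow_add h3, mul_comm]
        ring_nf
    _ ≤ 1 * t ^ (-α) := by gcongr
    _ = t ^ (-α) := one_mul _

lemma eventually_rpow_le_psi {n : ℕ} {θ : Fin n → ℝ} {β : ℝ} (hβ : 0 ≤ β)
    (h : lambdaOrd θ < ENNReal.ofReal β) :
    ∀ᶠ t in Filter.atTop, t ^ (-β) ≤ psi θ t := by
  have htop : Filter.liminf (fun t : ℝ => ENNReal.ofReal (t ^ β * psi θ t)) Filter.atTop = ⊤ := by
    by_contra hne
    exact h.not_ge (le_sSup ⟨β, hβ, rfl, lt_top_iff_ne_top.mpr hne⟩)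
  have h1 : (1 : ℝ≥0∞) < Filter.liminf
      (fun t : ℝ => ENNReal.ofReal (t ^ β * psi θ t)) Filter.atTop := htop ▸ ENNReal.one_lt_top
  filter_upwards [Filter.eventually_lt_of_lt_liminf h1, Filter.eventually_gt_atTop 0] with t h2 h3
  have h4 : 1 < t ^ β * psi θ t := ENNReal.one_lt_ofReal.mp h2
  have hp : 0 < t ^ β := Real.rpow_pos_of_pos h3 _
  rw [Real.rpow_neg h3.le, inv_le_iff_one_le_mul₀ hp, mul_comm]
  exact h4.le

lemma pow_mul_geom_sum_inv {g : ℝ} (hg : g ≠ 0) (m : ℕ) :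
    g ^ m * ∑ i ∈ Finset.range (m + 1), g⁻¹ ^ i = ∑ i ∈ Finset.range (m + 1), g ^ i := by
  rw [← Finset.sum_range_reflect (fun i => g ^ i), Finset.mul_sum]
  refine Finset.sum_congr rfl fun i hi => ?_
  have hi : i ≤ m := by simpa [Nat.lt_succ_iff] using hi
  rw [show m + 1 - 1 - i = m - i by omega, pow_sub₀ g hg hi, inv_pow]

lemma one_sub_geom_sum_of_Rpoly_eq_zero {m : ℕ} {α g : ℝ} (hα : α < 1) (hg : 0 < g)
    (h : Rpoly (m + 1) α g = 0) : 1 - α * ∑ i ∈ Finset.range (m + 1), g⁻¹ ^ i = 0 := by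
  have h1 : 1 - α ≠ 0 := by linarith
  rw [Rpoly, Nat.add_sub_cancel] at h
  have hp : g ^ m ≠ 0 := pow_ne_zero _ hg.ne'
  have h2 : g ^ m = α * ∑ i ∈ Finset.range (m + 1), g ^ i := by
    rw [Finset.sum_range_succ]
    field_simp at h
    linarith
  refine (mul_eq_zero.mp ?_).resolve_left hp
  rw [mul_sub, mul_left_comm, pow_mul_geom_sum_inv hg.ne', ← h2]
  ring

/-- If `1, θ_1, …, θ_n` are `ℚ`-linearly independent and `λ̂(θ) < 1`, then
`λ(θ) ≥ λ̂(θ) · G(n, λ̂(θ))` where `G(n, λ̂(θ))` is the unique positive root of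
`R_{n, λ̂(θ)}`. -/
theorem statement0 {n : ℕ} (hn : 2 ≤ n) (θ : Fin n → ℝ)
    (hθ : LinearIndependent ℚ (Fin.cons (1 : ℝ) θ : Fin (n + 1) → ℝ))
    (hhat : lambdaUnif θ < 1) :
    ∀ g : ℝ, 0 < g → Rpoly n (lambdaUnif θ).toReal g = 0 →
      ENNReal.ofReal ((lambdaUnif θ).toReal * g) ≤ lambdaOrd θ := by
  intro g hg hR
  obtain ⟨m, rfl⟩ : ∃ m, n = m + 1 := ⟨n - 1, by omega⟩
  by_contra! hlt
  have hfin : lambdaUnif θ ≠ ⊤ := (hhat.trans ENNReal.one_lt_top).ne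
  set α := (lambdaUnif θ).toReal with hαdef
  have hα1 : α < 1 := by
    simpa using (ENNReal.toReal_lt_toReal hfin ENNReal.one_ne_top).mpr hhat
  have hα : 0 < α := by
    have := ENNReal.ofReal_pos.mp (bot_le.trans_lt hlt)
    exact pos_of_mul_pos_left this hg.le
  have hroot := one_sub_geom_sum_of_Rpoly_eq_zero hα1 hg hR
  have hpre : 0 < 1 - α * ∑ i ∈ Finset.range m, g⁻¹ ^ i := by
    rw [Finset.sum_range_succ] at hroot
    have : 0 < α * g⁻¹ ^ m := by positivity
    linarith
  have hcont : ContinuousAt (fun g : ℝ => 1 - α * ∑ i ∈ Finset.range m, g⁻¹ ^ i) g := by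
    fun_prop (disch := exact hg.ne')
  have hcont' : ContinuousAt (fun g : ℝ => ENNReal.ofReal (α * g)) g :=
    (ENNReal.continuous_ofReal.comp (continuous_const_mul α)).continuousAt
  obtain ⟨g', ⟨⟨hg'1, hg'2⟩, hg'0⟩, hg'⟩ :=
    ((((hcont.eventually_const_lt hpre).and (hcont'.eventually_const_lt hlt)).and
      (lt_mem_nhds hg)).filter_mono (nhdsWithin_le_nhds (s := Set.Iio g))).and
      self_mem_nhdsWithin |>.exists
  have hg' : g' < g := hg'
  have hneg : 1 - α * ∑ i ∈ Finset.range (m + 1), g'⁻¹ ^ i < 0 := by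
    rw [← hroot]
    have hinv : g⁻¹ < g'⁻¹ := inv_strictAnti₀ hg'0 hg'
    have : ∑ i ∈ Finset.range (m + 1), g⁻¹ ^ i < ∑ i ∈ Finset.range (m + 1), g'⁻¹ ^ i := by
      refine Finset.sum_lt_sum (fun i _ => by gcongr) ⟨1, by simp; omega, by simpa using hinv⟩
    nlinarith
  have hcont1 : ContinuousAt
      (fun a : ℝ => 1 - a * ∑ i ∈ Finset.range (m + 1), g'⁻¹ ^ i) α := by fun_prop
  have hcont2 : ContinuousAt (fun a : ℝ => ENNReal.ofReal (a * g')) α :=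
    (ENNReal.continuous_ofReal.comp (continuous_mul_const g')).continuousAt
  obtain ⟨α', ⟨⟨hα'1, hα'2⟩, hα'0⟩, hα'⟩ :=
    ((((hcont1.eventually_lt_const hneg).and (hcont2.eventually_const_lt hg'2)).and
      (lt_mem_nhds hα)).filter_mono (nhdsWithin_le_nhds (s := Set.Iio α))).and
      self_mem_nhdsWithin |>.exists
  have hα' : α' < α := hα'
  have hup := eventually_psi_le_rpow (θ := θ) (α := α') <| by
    rw [← ENNReal.ofReal_toReal hfin]
    exact (ENNReal.ofReal_lt_ofReal_iff hα).mpr hα'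
  obtain ⟨T, hT⟩ := Filter.eventually_atTop.mp
    (hup.and (eventually_rpow_le_psi (mul_pos hα'0 hg'0).le hα'2))
  refine false_of_psi_bounds θ hθ hα'0 hg'0 (fun t ht => (hT t ht).1) (fun t ht => (hT t ht).2)
    ?_ hα'1
  have : 0 ≤ ∑ i ∈ Finset.range m, g'⁻¹ ^ i := Finset.sum_nonneg fun i _ => by positivity
  nlinarith

end
end

section
/- Let n ≥ 2 be an integer and let θ = (θ_1,…,θ_n) ∈ ℝ^n be such that 1, θ_1, …, θ_n are linearly independent over ℚ. Suppose the uniform exponent satisfies ω̂(θ) < +∞. Then the ordinary exponent satisfies ω(θ) ≥ ω̂(θ) · G*(n, ω̂(θ)), where G*(n, ω̂(θ)) is the unique positive real root of R*_{n,ω̂(θ)} (the inequality is read in [0,+∞], ω(θ) possibly being +∞). -/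
open scoped BigOperators ENNReal

noncomputable section

/-- `R*_{n,α*}(x) = x^(n-1) + x^(n-2) + ⋯ + x + 1 - α*`. -/
def Rstar (n : ℕ) (αs : ℝ) (x : ℝ) : ℝ :=
  (∑ i ∈ Finset.range n, x ^ i) - αs

/-- Irrationality measure function for approximation by one linear form:
`φ(t) = min { ‖q₁θ₁ + ⋯ + qₙθₙ‖ : q ∈ ℤⁿ, 0 < max_j |q_j| ≤ t }`. -/
def phi {n : ℕ} (θ : Fin n → ℝ) (t : ℝ) : ℝ :=
  sInf {v : ℝ | ∃ q : Fin n → ℤ, q ≠ 0 ∧ (⨆ j : Fin n, |(q j : ℝ)|) ≤ t ∧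
    v = nint (∑ j : Fin n, (q j : ℝ) * θ j)}

/-- Ordinary exponent of approximation by one linear form, in `[0,∞]`. -/
def omegaOrd {n : ℕ} (θ : Fin n → ℝ) : ℝ≥0∞ :=
  sSup {x : ℝ≥0∞ | ∃ w : ℝ, 0 ≤ w ∧ x = ENNReal.ofReal w ∧
    Filter.liminf (fun t : ℝ => ENNReal.ofReal (t ^ w * phi θ t)) Filter.atTop < ⊤}

/-- Uniform exponent of approximation by one linear form, in `[0,∞]`. -/
def omegaUnif {n : ℕ} (θ : Fin n → ℝ) : ℝ≥0∞ :=
  sSup {x : ℝ≥0∞ | ∃ w : ℝ, 0 ≤ w ∧ x = ENNReal.ofReal w ∧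
    Filter.limsup (fun t : ℝ => ENNReal.ofReal (t ^ w * phi θ t)) Filter.atTop < ⊤}

/-- The points `(p + q·θ, q)` with `p ∈ ℤ`, `q ∈ ℤⁿ`. -/
def IsFormPoint {n : ℕ} (θ : Fin n → ℝ) (x : Fin (n + 1) → ℝ) : Prop :=
  ∃ (p : ℤ) (q : Fin n → ℤ),
    x = Fin.cons ((p : ℝ) + ∑ j, (q j : ℝ) * θ j) (fun j => (q j : ℝ))

/-- `T` is spanned by `j` form points `y` whose exterior product equals that of vectors `z`, where
all but one of the `z i` have vanishing zeroth coordinate and the resulting volume bound of the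
parallelepiped is at most `v`. -/
def HasVolumeBound {n : ℕ} (θ : Fin n → ℝ) (T : Submodule ℝ (Fin (n + 1) → ℝ)) (j : ℕ) (v : ℝ) :
    Prop :=
  ∃ (y z : Fin j → Fin (n + 1) → ℝ) (c : Fin j → ℝ) (i₀ : Fin j),
    (∀ i, IsFormPoint θ (y i)) ∧ Submodule.span ℝ (Set.range z) = T ∧
    (∀ f : (Fin (n + 1) → ℝ) [⋀^Fin j]→ₗ[ℝ] ℝ, f y = f z) ∧
    (∀ i, 0 ≤ c i) ∧ (∀ i, i ≠ i₀ → z i 0 = 0 ∧ ∀ k, k ≠ 0 → |z i k| ≤ c i) ∧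
    |z i₀ 0| ≤ c i₀ ∧ ∏ i, c i ≤ v

lemma HasVolumeBound.mono {n : ℕ} {θ : Fin n → ℝ} {T : Submodule ℝ (Fin (n + 1) → ℝ)} {j : ℕ}
    {v v' : ℝ} (h : HasVolumeBound θ T j v) (hv : v ≤ v') : HasVolumeBound θ T j v' := by
  obtain ⟨y, z, c, i₀, h1, h2, h3, h4, h5, h6, h7⟩ := h
  exact ⟨y, z, c, i₀, h1, h2, h3, h4, h5, h6, h7.trans hv⟩

lemma hasVolumeBound_span_singleton {n : ℕ} {θ : Fin n → ℝ} {x : Fin (n + 1) → ℝ}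
    (hx : IsFormPoint θ x) : HasVolumeBound θ (Submodule.span ℝ {x}) 1 |x 0| := by
  refine ⟨fun _ => x, fun _ => x, fun _ => |x 0|, 0, fun _ => hx, ?_, fun _ => rfl,
    fun _ => abs_nonneg _, ?_, le_rfl, by simp⟩
  · rw [Set.range_const]
  · intro i hi
    exact absurd (Subsingleton.elim i 0) hi

lemma AlternatingMap.curryLeft_eq_zero_of_mem_span {E : Type*} [AddCommGroup E] [Module ℝ E]
    {j : ℕ} (f : E [⋀^Fin (j + 1)]→ₗ[ℝ] ℝ) (z : Fin j → E) {w : E}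
    (hw : w ∈ Submodule.span ℝ (Set.range z)) : f.curryLeft w z = 0 := by
  induction hw using Submodule.span_induction with
  | mem x hx =>
    obtain ⟨i, rfl⟩ := hx
    rw [AlternatingMap.curryLeft_apply_apply]
    exact f.map_eq_zero_of_eq _ (i := 0) (j := i.succ) (by simp) (Fin.succ_ne_zero i).symm
  | zero => simp
  | add x y _ _ hx hy => simp only [map_add, AlternatingMap.add_apply, hx, hy, add_zero]
  | smul a x _ hx => simp only [map_smul, AlternatingMap.smul_apply, hx, smul_zero]

lemma HasVolumeBound.sup_span_singleton {n : ℕ} {θ : Fin n → ℝ}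
    {T : Submodule ℝ (Fin (n + 1) → ℝ)} {j : ℕ} {v K : ℝ} (h : HasVolumeBound θ T j v)
    {w x : Fin (n + 1) → ℝ} (hw : w ∈ T) (hw0 : w 0 ≠ 0) (hx : IsFormPoint θ x) (hK : 0 ≤ K)
    (hxK : ∀ k, k ≠ 0 → |x k - x 0 / w 0 * w k| ≤ K) :
    HasVolumeBound θ (T ⊔ Submodule.span ℝ {x}) (j + 1) (v * K) := by
  obtain ⟨y, z, c, i₀, h1, h2, h3, h4, h5, h6, h7⟩ := h
  refine ⟨Fin.cons x y, Fin.cons (x - (x 0 / w 0) • w) z, Fin.cons K c, i₀.succ, ?_, ?_, ?_, ?_, ?_,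
    ?_, ?_⟩
  · intro i
    refine Fin.cases ?_ ?_ i
    · simpa using hx
    · simpa using h1
  · rw [Fin.range_cons, Submodule.span_insert, h2, sup_comm]
    apply le_antisymm
    · refine sup_le le_sup_left ?_
      rw [Submodule.span_singleton_le_iff_mem]
      exact Submodule.sub_mem _ (Submodule.mem_sup_right (Submodule.mem_span_singleton_self x))
        (Submodule.smul_mem _ _ (Submodule.mem_sup_left hw))
    · refine sup_le le_sup_left ?_
      rw [Submodule.span_singleton_le_iff_mem]
      have := Submodule.add_mem (T ⊔ Submodule.span ℝ {x - (x 0 / w 0) • w})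
        (Submodule.mem_sup_right (Submodule.mem_span_singleton_self _))
        (Submodule.mem_sup_left (Submodule.smul_mem _ (x 0 / w 0) hw))
      simpa using this
  · intro f
    have hwz : f.curryLeft w z = 0 :=
      AlternatingMap.curryLeft_eq_zero_of_mem_span f z (h2.symm ▸ hw)
    have e1 : f (Fin.cons x y) = f.curryLeft x y := rfl
    have e2 : f (Fin.cons (x - (x 0 / w 0) • w) z) = f.curryLeft (x - (x 0 / w 0) • w) z := rfl
    rw [e1, e2, h3, map_sub, map_smul, AlternatingMap.sub_apply, AlternatingMap.smul_apply, hwz,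
      smul_zero, sub_zero]
  · intro i
    refine Fin.cases ?_ ?_ i
    · simpa using hK
    · simpa using h4
  · intro i
    refine Fin.cases ?_ ?_ i
    · intro _
      refine ⟨?_, ?_⟩
      · simp [div_mul_cancel₀ _ hw0]
      · intro k hk
        simpa using hxK k hk
    · intro i hi
      have := h5 i (fun h => hi (by rw [h]))
      simpa using this
  · simpa using h6
  · rw [Fin.prod_cons, mul_comm]
    exact mul_le_mul_of_nonneg_right h7 hK

lemma abs_det_le_of_first_column {m : ℕ} (Z : Matrix (Fin (m + 1)) (Fin (m + 1)) ℝ)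
    (c : Fin (m + 1) → ℝ) (i₀ : Fin (m + 1))
    (hz : ∀ i, i ≠ i₀ → Z i 0 = 0 ∧ ∀ k, k ≠ 0 → |Z i k| ≤ c i) (h₀ : |Z i₀ 0| ≤ c i₀)
    (hc : ∀ i, 0 ≤ c i) : |Z.det| ≤ (m + 1).factorial * ∏ i, c i := by
  rw [Matrix.det_apply]
  refine (Finset.abs_sum_le_sum_abs _ _).trans ?_
  have key : ∀ σ ∈ (Finset.univ : Finset (Equiv.Perm (Fin (m + 1)))),
      |Equiv.Perm.sign σ • ∏ i, Z (σ i) i| ≤ ∏ i, c i := by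
    intro σ _
    have hs : |Equiv.Perm.sign σ • ∏ i, Z (σ i) i| = |∏ i, Z (σ i) i| := by
      rcases Int.units_eq_one_or (Equiv.Perm.sign σ) with h | h <;> rw [h] <;> simp
    rw [hs, Finset.abs_prod]
    by_cases h : σ 0 = i₀
    · rw [← Equiv.prod_comp σ c]
      refine Finset.prod_le_prod (fun _ _ => abs_nonneg _) fun i _ => ?_
      by_cases hi : i = 0
      · subst hi
        rw [h]
        exact h₀
      · exact (hz (σ i) fun h' => hi (σ.injective (h'.trans h.symm))).2 i hi
    · rw [Finset.prod_eq_zero (Finset.mem_univ 0) (by rw [(hz _ h).1, abs_zero])]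
      exact Finset.prod_nonneg fun i _ => hc i
  refine (Finset.sum_le_card_nsmul _ _ _ key).trans_eq ?_
  rw [Finset.card_univ, Fintype.card_perm, Fintype.card_fin, nsmul_eq_mul]

lemma exists_int_det_of_isFormPoint {n : ℕ} {θ : Fin n → ℝ}
    (y : Matrix (Fin (n + 1)) (Fin (n + 1)) ℝ) (hy : ∀ i, IsFormPoint θ (y i)) :
    ∃ d : ℤ, y.det = d := by
  choose p q hpq using hy
  let M : Matrix (Fin (n + 1)) (Fin (n + 1)) ℤ := Matrix.of fun i => Fin.cons (p i) (q i)
  let U : Matrix (Fin (n + 1)) (Fin (n + 1)) ℝ := Matrix.of fun i k =>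
    if k = 0 then (Fin.cons 1 θ : Fin (n + 1) → ℝ) i else if i = k then 1 else 0
  have hU : U.det = 1 := by
    rw [Matrix.det_of_isLowerTriangular]
    · refine Finset.prod_eq_one fun i _ => ?_
      by_cases hi : i = 0
      · subst hi; simp [U]
      · simp [U, hi]
    · intro i k hik
      have hik' : i < k := hik
      have hk : k ≠ 0 := fun h => by simp [h] at hik'
      simp [U, hk, hik'.ne]
  have hyMU : y = M.map (Int.cast : ℤ → ℝ) * U := by
    ext i k
    rw [hpq i, Matrix.mul_apply, Fin.sum_univ_succ]
    refine Fin.cases ?_ (fun k => ?_) k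
    · simp [M, U]
    · simp [M, U, Fin.succ_ne_zero, (Fin.succ_ne_zero k).symm]
  refine ⟨M.det, ?_⟩
  rw [hyMU, Matrix.det_mul, hU, mul_one]
  exact (Int.cast_det M).symm

lemma HasVolumeBound.one_le_of_top {n : ℕ} {θ : Fin n → ℝ} {v : ℝ}
    (h : HasVolumeBound θ ⊤ (n + 1) v) : 1 ≤ (n + 1).factorial * v := by
  obtain ⟨y, z, c, i₀, h1, h2, h3, h4, h5, h6, h7⟩ := h
  have hdet : Matrix.det (Matrix.of y) = Matrix.det (Matrix.of z) := h3 Matrix.detRowAlternating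
  have hz : LinearIndependent ℝ z :=
    linearIndependent_of_top_le_span_of_card_eq_finrank h2.ge (by simp)
  have hz0 : Matrix.det (Matrix.of z) ≠ 0 := by
    have : LinearIndependent ℝ (Matrix.of z).row := hz
    rw [Matrix.linearIndependent_rows_iff_isUnit, Matrix.isUnit_iff_isUnit_det] at this
    exact this.ne_zero
  obtain ⟨d, hd⟩ := exists_int_det_of_isFormPoint (Matrix.of y) h1
  have hd0 : d ≠ 0 := by
    rintro rfl
    rw [← hdet, hd] at hz0
    simp at hz0
  have h1d : (1 : ℝ) ≤ |(d : ℝ)| := by exact_mod_cast Int.one_le_abs hd0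
  calc (1 : ℝ) ≤ |Matrix.det (Matrix.of z)| := by rw [← hdet, hd]; exact h1d
    _ ≤ (n + 1).factorial * ∏ i, c i := abs_det_le_of_first_column _ c i₀ h5 h6 h4
    _ ≤ _ := by gcongr

lemma exists_isFormPoint_notMem {n : ℕ} (θ : Fin n → ℝ) {S : Submodule ℝ (Fin (n + 1) → ℝ)}
    (hS : S ≠ ⊤) : ∃ x, IsFormPoint θ x ∧ x ∉ S := by
  by_contra! hcon
  apply hS
  have h0 : (Pi.single 0 1 : Fin (n + 1) → ℝ) ∈ S := by
    refine hcon _ ⟨1, 0, ?_⟩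
    ext k
    refine Fin.cases ?_ (fun k => ?_) k <;> simp
  have hsucc : ∀ j : Fin n, (Pi.single j.succ 1 : Fin (n + 1) → ℝ) ∈ S := by
    intro j
    have hj := hcon (Fin.cons (((0 : ℤ) : ℝ) + ∑ i, ((Pi.single j (1 : ℤ) : Fin n → ℤ) i : ℝ) * θ i)
      (fun i => ((Pi.single j (1 : ℤ) : Fin n → ℤ) i : ℝ))) ⟨0, Pi.single j 1, rfl⟩
    have := S.sub_mem hj (S.smul_mem (θ j) h0)
    convert this using 1
    ext k
    refine Fin.cases ?_ (fun k => ?_) k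
    · simp [Pi.single_apply]
    · simp [Pi.single_apply]
  rw [eq_top_iff]
  intro x _
  rw [← Finset.univ_sum_single x]
  refine S.sum_mem fun i _ => ?_
  have : (Pi.single i (x i) : Fin (n + 1) → ℝ) = x i • Pi.single i 1 := by
    rw [← Pi.single_smul]; simp
  rw [this]
  refine S.smul_mem _ ?_
  exact Fin.cases h0 hsucc i

lemma exists_pos_le_of_hasVolumeBound {n : ℕ} (θ : Fin n → ℝ) {w : Fin (n + 1) → ℝ}
    (hw0 : w 0 ≠ 0) (S : Submodule ℝ (Fin (n + 1) → ℝ)) (hwS : w ∈ S) :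
    ∃ c : ℝ, 0 < c ∧ ∀ v, HasVolumeBound θ S (Module.finrank ℝ S) v → c ≤ v := by
  induction hd : n + 1 - Module.finrank ℝ S generalizing S with
  | zero =>
    have hle : Module.finrank ℝ S ≤ n + 1 := by simpa using S.finrank_le
    have hS : S = ⊤ := Submodule.eq_top_of_finrank_eq (by simp; omega)
    subst hS
    refine ⟨1 / (n + 1).factorial, by positivity, fun v hv => ?_⟩
    rw [finrank_top, Module.finrank_fin_fun] at hv
    rw [div_le_iff₀' (by positivity)]
    exact hv.one_le_of_top
  | succ d ih =>
    have hS : S ≠ ⊤ := by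
      rintro rfl
      simp at hd
    obtain ⟨x, hx, hxS⟩ := exists_isFormPoint_notMem θ hS
    have hfin := Submodule.finrank_sup_span_singleton hxS
    obtain ⟨c, hc, hcv⟩ := ih (S ⊔ Submodule.span ℝ {x}) (Submodule.mem_sup_left hwS) (by omega)
    obtain ⟨K, hK⟩ : ∃ K, ∀ k, |x k - x 0 / w 0 * w k| ≤ K :=
      ⟨∑ k, |x k - x 0 / w 0 * w k|, fun k =>
        Finset.single_le_sum (f := fun k => |x k - x 0 / w 0 * w k|)
          (fun _ _ => abs_nonneg _) (Finset.mem_univ k)⟩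
    have hK0 : 0 ≤ K := (abs_nonneg _).trans (hK 0)
    refine ⟨c / (K + 1), by positivity, fun v hv => ?_⟩
    have := hv.sup_span_singleton hwS hw0 hx (K := K + 1) (by positivity)
      fun k _ => (hK k).trans (by linarith)
    rw [← hfin] at this
    rw [div_le_iff₀ (by positivity)]
    exact hcv _ this

lemma exists_initial_span_of_finrank {E : Type*} [AddCommGroup E] [Module ℝ E]
    [FiniteDimensional ℝ E] (x : ℕ → E) {j k l : ℕ} (hkl : k ≤ l)
    (h : Module.finrank ℝ (Submodule.span ℝ (x '' Set.Icc k l)) = j + 2) :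
    ∃ m, k ≤ m ∧ m + 1 ≤ l ∧ Module.finrank ℝ (Submodule.span ℝ (x '' Set.Icc k m)) = j + 1 ∧
      Submodule.span ℝ (x '' Set.Icc k l) =
        Submodule.span ℝ (x '' Set.Icc k m) ⊔ Submodule.span ℝ {x (m + 1)} := by
  induction l, hkl using Nat.le_induction with
  | base =>
    rw [Set.Icc_self, Set.image_singleton] at h
    have := finrank_span_le_card (R := ℝ) ({x k} : Set E)
    simp at this
    omega
  | succ l hkl ih =>
    have hI : Set.Icc k (l + 1) = insert (l + 1) (Set.Icc k l) := by
      ext i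
      simp only [Set.mem_Icc, Set.mem_insert_iff]
      omega
    have hs : Submodule.span ℝ (x '' Set.Icc k (l + 1)) =
        Submodule.span ℝ (x '' Set.Icc k l) ⊔ Submodule.span ℝ {x (l + 1)} := by
      rw [hI, Set.image_insert_eq, Submodule.span_insert, sup_comm]
    by_cases hx : x (l + 1) ∈ Submodule.span ℝ (x '' Set.Icc k l)
    · have hs' : Submodule.span ℝ (x '' Set.Icc k (l + 1)) =
          Submodule.span ℝ (x '' Set.Icc k l) := by
        rw [hs, sup_eq_left, Submodule.span_singleton_le_iff_mem]
        exact hx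
      rw [hs'] at h ⊢
      obtain ⟨m, h1, h2, h3, h4⟩ := ih h
      exact ⟨m, h1, by omega, h3, h4⟩
    · refine ⟨l, hkl, le_rfl, ?_, hs⟩
      rw [hs, Submodule.finrank_sup_span_singleton hx] at h
      omega

lemma exists_final_span_of_finrank {E : Type*} [AddCommGroup E] [Module ℝ E]
    [FiniteDimensional ℝ E] (x : ℕ → E) {j k l : ℕ} (hkl : k ≤ l)
    (h : Module.finrank ℝ (Submodule.span ℝ (x '' Set.Icc k l)) = j + 2) :
    ∃ p, k ≤ p ∧ p + 1 ≤ l ∧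
      Module.finrank ℝ (Submodule.span ℝ (x '' Set.Icc (p + 1) l)) = j + 1 ∧
      Submodule.span ℝ (x '' Set.Icc k l) =
        Submodule.span ℝ (x '' Set.Icc (p + 1) l) ⊔ Submodule.span ℝ {x p} := by
  induction hd : l - k generalizing k with
  | zero =>
    obtain rfl : k = l := by omega
    rw [Set.Icc_self, Set.image_singleton] at h
    have := finrank_span_le_card (R := ℝ) ({x k} : Set E)
    simp at this
    omega
  | succ d ih =>
    have hI : Set.Icc k l = insert k (Set.Icc (k + 1) l) := by
      ext i
      simp only [Set.mem_Icc, Set.mem_insert_iff]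
      omega
    have hs : Submodule.span ℝ (x '' Set.Icc k l) =
        Submodule.span ℝ (x '' Set.Icc (k + 1) l) ⊔ Submodule.span ℝ {x k} := by
      rw [hI, Set.image_insert_eq, Submodule.span_insert, sup_comm]
    by_cases hx : x k ∈ Submodule.span ℝ (x '' Set.Icc (k + 1) l)
    · have hs' : Submodule.span ℝ (x '' Set.Icc k l) =
          Submodule.span ℝ (x '' Set.Icc (k + 1) l) := by
        rw [hs, sup_eq_left, Submodule.span_singleton_le_iff_mem]
        exact hx
      rw [hs'] at h ⊢
      obtain ⟨p, h1, h2, h3, h4⟩ := ih (by omega) h (by omega)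
      exact ⟨p, by omega, h2, h3, h4⟩
    · refine ⟨k, le_rfl, by omega, ?_, hs⟩
      rw [hs, Submodule.finrank_sup_span_singleton hx] at h
      omega

lemma exponent_bound_of_next {α s P a d b C : ℝ} (hα : 0 < α) (hP : 0 < P) (hs : s + P < α)
    (h1 : (α - s) / P * a - C ≤ d) (h2 : (α - s) / α * b - C ≤ d) :
    (α - (s + P)) / α * b - C ≤ d - a := by
  have hs0 : 0 < α - s := by linarith
  set t := P / (α - s) with ht
  have ht1 : t ≤ 1 := by rw [ht, div_le_one hs0]; linarith
  have ht0 : 0 ≤ t := by positivity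
  have e1 : t * ((α - s) / P * a - C) = a - t * C := by rw [ht]; field_simp
  have e2 : (1 - t) * ((α - s) / α * b - C) = (α - (s + P)) / α * b - (1 - t) * C := by
    rw [ht]; field_simp; ring
  have i1 := mul_le_mul_of_nonneg_left h1 ht0
  have i2 := mul_le_mul_of_nonneg_left h2 (sub_nonneg.2 ht1)
  rw [e1] at i1
  rw [e2] at i2
  linarith

lemma exponent_bound_of_prev {α G s P a d b b' a' C C₀ : ℝ} (hα : 1 ≤ α) (hG : 1 ≤ G) (hP : 0 < P)
    (hs : 1 + G * s < α) (hs0 : s < α) (h1 : (α - s) / P * a - C ≤ d)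
    (h2 : (α - s) / α * b - C ≤ d) (h3 : α * a' - C₀ ≤ b') (h4 : b ≤ α * G * a') :
    (α - (1 + G * s)) / (P * G) * a - C - C₀ ≤ d + b' - a' - b := by
  have hs1 : 0 < α - s := by linarith
  have hα0 : 0 < α := by linarith
  have hG0 : 0 < G := by linarith
  set u := (α * G - (α - 1)) / (G * (α - s)) with hu
  have hu0 : 0 ≤ u := by
    have : 0 ≤ α * G - (α - 1) := by nlinarith
    positivity
  have hu1 : u ≤ 1 := by rw [hu, div_le_one (by positivity)]; nlinarith
  have e1 : (1 - u) * ((α - s) / P * a - C) =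
      (α - (1 + G * s)) / (P * G) * a - (1 - u) * C := by
    rw [hu]; field_simp; ring
  have e2 : u * ((α - s) / α * b - C) = (1 - (α - 1) / (α * G)) * b - u * C := by
    rw [hu]; field_simp
  have i1 := mul_le_mul_of_nonneg_left h1 (sub_nonneg.2 hu1)
  have i2 := mul_le_mul_of_nonneg_left h2 hu0
  have i3 : (α - 1) / (α * G) * b ≤ (α - 1) * a' := by
    calc (α - 1) / (α * G) * b ≤ (α - 1) / (α * G) * (α * G * a') := by
          apply mul_le_mul_of_nonneg_left h4
          have : 0 ≤ α - 1 := by linarith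
          positivity
      _ = (α - 1) * a' := by field_simp
  rw [e1] at i1
  rw [e2] at i2
  linarith

/-- A sequence of form points `x k` of height at most `k`, with logarithmic decay `b k` of the
linear form lying between `α log (k + 1)` and `α G log k`, from the index `N` on. -/
structure ApproxSequence {n : ℕ} (θ : Fin n → ℝ) (x : ℕ → Fin (n + 1) → ℝ) (b : ℕ → ℝ)
    (α G C₀ : ℝ) (N : ℕ) : Prop where
  one_le : 1 ≤ N
  isFormPoint : ∀ k, N ≤ k → IsFormPoint θ (x k)
  abs_zero : ∀ k, N ≤ k → |x k 0| = Real.exp (-b k)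
  mono : ∀ k l, N ≤ k → k ≤ l → b k ≤ b l
  abs_le : ∀ k, N ≤ k → ∀ i, i ≠ 0 → |x k i| ≤ k
  lower : ∀ k, N ≤ k → α * Real.log (k + 1) - C₀ ≤ b k
  upper : ∀ k, N ≤ k → b k ≤ α * G * Real.log k

namespace ApproxSequence

variable {n : ℕ} {θ : Fin n → ℝ} {x : ℕ → Fin (n + 1) → ℝ} {b : ℕ → ℝ} {α G C₀ : ℝ} {N : ℕ}

lemma apply_zero_ne_zero (h : ApproxSequence θ x b α G C₀ N) {k : ℕ} (hk : N ≤ k) :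
    x k 0 ≠ 0 := by
  rw [← abs_pos, h.abs_zero k hk]
  exact Real.exp_pos _

lemma abs_div (h : ApproxSequence θ x b α G C₀ N) {k l : ℕ} (hk : N ≤ k) (hl : N ≤ l) :
    |x k 0 / x l 0| = Real.exp (b l - b k) := by
  rw [_root_.abs_div, h.abs_zero k hk, h.abs_zero l hl, ← Real.exp_sub]
  congr 1
  ring

lemma hasVolumeBound_sup_next (h : ApproxSequence θ x b α G C₀ N)
    {T : Submodule ℝ (Fin (n + 1) → ℝ)} {j m : ℕ} {d : ℝ} (hm : N ≤ m) (hx : x m ∈ T)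
    (hT : HasVolumeBound θ T j (Real.exp (-d))) :
    HasVolumeBound θ (T ⊔ Submodule.span ℝ {x (m + 1)}) (j + 1)
      (Real.exp (-(d - Real.log (m + 1) - Real.log 2))) := by
  have hm' : N ≤ m + 1 := by omega
  have := hT.sup_span_singleton hx (h.apply_zero_ne_zero hm) (h.isFormPoint _ hm')
    (K := 2 * (m + 1)) (by positivity) ?_
  · refine this.mono (le_of_eq ?_)
    rw [show -(d - Real.log (m + 1) - Real.log 2) = -d + (Real.log 2 + Real.log (m + 1)) by ring,
      Real.exp_add, Real.exp_add, Real.exp_log (by norm_num), Real.exp_log (by positivity)]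
  · intro k hk
    have h1 := h.abs_le _ hm' k hk
    have h2 := h.abs_le _ hm k hk
    have h3 : |x (m + 1) 0 / x m 0| ≤ 1 := by
      rw [h.abs_div hm' hm, Real.exp_le_one_iff]
      linarith [h.mono m (m + 1) hm (by omega)]
    calc _ ≤ |x (m + 1) k| + |x (m + 1) 0 / x m 0 * x m k| := abs_sub _ _
      _ ≤ |x (m + 1) k| + 1 * |x m k| := by rw [abs_mul]; gcongr
      _ ≤ _ := by push_cast at h1; linarith

lemma hasVolumeBound_sup_prev (h : ApproxSequence θ x b α G C₀ N)
    {T : Submodule ℝ (Fin (n + 1) → ℝ)} {j p : ℕ} {d : ℝ} (hp : N ≤ p) (hx : x (p + 1) ∈ T)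
    (hT : HasVolumeBound θ T j (Real.exp (-d))) :
    HasVolumeBound θ (T ⊔ Submodule.span ℝ {x p}) (j + 1)
      (Real.exp (-(d + b p - Real.log (p + 1) - b (p + 1) - Real.log 2))) := by
  have hp' : N ≤ p + 1 := by omega
  have := hT.sup_span_singleton hx (h.apply_zero_ne_zero hp') (h.isFormPoint _ hp)
    (K := 2 * (p + 1) * Real.exp (b (p + 1) - b p)) (by positivity) ?_
  · refine this.mono (le_of_eq ?_)
    rw [show -(d + b p - Real.log (p + 1) - b (p + 1) - Real.log 2) =
        -d + (Real.log 2 + Real.log (p + 1) + (b (p + 1) - b p)) by ring,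
      Real.exp_add, Real.exp_add, Real.exp_add _ (Real.log (p + 1)), Real.exp_log (by norm_num),
      Real.exp_log (by positivity)]
  · intro k hk
    have h1 := h.abs_le _ hp' k hk
    have h2 := h.abs_le _ hp k hk
    have h3 : 1 ≤ Real.exp (b (p + 1) - b p) := by
      rw [Real.one_le_exp_iff]
      linarith [h.mono p (p + 1) hp (by omega)]
    calc _ ≤ |x p k| + |x p 0 / x (p + 1) 0 * x (p + 1) k| := abs_sub _ _
      _ = |x p k| * 1 + Real.exp (b (p + 1) - b p) * |x (p + 1) k| := by
        rw [abs_mul, h.abs_div hp hp', mul_one]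
      _ ≤ (p + 1) * Real.exp (b (p + 1) - b p) + Real.exp (b (p + 1) - b p) * (p + 1) := by
        push_cast at h1
        gcongr
        linarith
      _ = _ := by ring

lemma exists_hasVolumeBound (h : ApproxSequence θ x b α G C₀ N) (hα : 1 ≤ α) (hG : 1 ≤ G)
    (j : ℕ) (hj : ∑ i ∈ Finset.range j, G ^ i < α) :
    ∃ C, ∀ k l, N ≤ k → k ≤ l →
      Module.finrank ℝ (Submodule.span ℝ (x '' Set.Icc k l)) = j + 1 →
      ∃ d, HasVolumeBound θ (Submodule.span ℝ (x '' Set.Icc k l)) (j + 1) (Real.exp (-d)) ∧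
        (α - ∑ i ∈ Finset.range j, G ^ i) / G ^ j * Real.log (l + 1) - C ≤ d ∧
        (α - ∑ i ∈ Finset.range j, G ^ i) / α * b k - C ≤ d := by
  have hα0 : 0 < α := by linarith
  have hG0 : 0 < G := by linarith
  induction j with
  | zero =>
    refine ⟨max C₀ 0, fun k l hk hkl hfin => ⟨b l, ?_, ?_, ?_⟩⟩
    · have hl : N ≤ l := hk.trans hkl
      have hx0 : x l ≠ 0 := fun h0 => h.apply_zero_ne_zero hl (by rw [h0]; rfl)
      have hle : Submodule.span ℝ {x l} ≤ Submodule.span ℝ (x '' Set.Icc k l) :=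
        Submodule.span_mono (by
          rw [Set.singleton_subset_iff]
          exact Set.mem_image_of_mem x ⟨hkl, le_rfl⟩)
      rw [← Submodule.eq_of_le_of_finrank_eq hle (by rw [hfin, finrank_span_singleton hx0]),
        ← h.abs_zero l hl]
      exact hasVolumeBound_span_singleton (h.isFormPoint l hl)
    · have := h.lower l (hk.trans hkl)
      have := le_max_left C₀ 0
      simp only [Finset.range_zero, Finset.sum_empty, sub_zero, pow_zero, div_one]
      linarith
    · have := h.mono k l hk hkl
      have := le_max_right C₀ 0
      simp only [Finset.range_zero, Finset.sum_empty, sub_zero, div_self hα0.ne', one_mul]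
      linarith
  | succ j ih =>
    have hP : 0 < G ^ j := by positivity
    have hs1 := Finset.sum_range_succ (fun i => G ^ i) j
    have hs2 := geom_sum_succ (x := G) (n := j)
    have hsj : ∑ i ∈ Finset.range j, G ^ i < α := by linarith
    obtain ⟨C, hC⟩ := ih hsj
    set s := ∑ i ∈ Finset.range j, G ^ i
    refine ⟨max (C + Real.log 2) (C + C₀ + Real.log 2), fun k l hk hkl hfin => ?_⟩
    have hC1 := le_max_left (C + Real.log 2) (C + C₀ + Real.log 2)
    have hC2 := le_max_right (C + Real.log 2) (C + C₀ + Real.log 2)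
    obtain ⟨m, hkm, hml, hfm, hsm⟩ := exists_initial_span_of_finrank x hkl hfin
    obtain ⟨p, hkp, hpl, hfp, hsp⟩ := exists_final_span_of_finrank x hkl hfin
    obtain ⟨d₁, hd₁, hd₁a, hd₁b⟩ := hC k m hk hkm hfm
    obtain ⟨d₂, hd₂, hd₂a, hd₂b⟩ := hC (p + 1) l (by omega) hpl hfp
    have v₁ := h.hasVolumeBound_sup_next (hk.trans hkm)
      (Submodule.subset_span (Set.mem_image_of_mem x (Set.right_mem_Icc.2 hkm))) hd₁
    have v₂ := h.hasVolumeBound_sup_prev (hk.trans hkp)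
      (Submodule.subset_span (Set.mem_image_of_mem x (Set.left_mem_Icc.2 hpl))) hd₂
    rw [← hsm] at v₁
    rw [← hsp] at v₂
    have b₁ := exponent_bound_of_next hα0 hP (by linarith) hd₁a hd₁b
    have b₂ := exponent_bound_of_prev hα hG hP (by linarith) hsj hd₂a hd₂b
      (h.lower p (hk.trans hkp)) (by simpa using h.upper (p + 1) (by omega))
    rw [← hs1] at b₁
    rw [add_comm 1, ← hs2, ← pow_succ] at b₂
    rcases le_total (d₁ - Real.log (m + 1) - Real.log 2)
      (d₂ + b p - Real.log (p + 1) - b (p + 1) - Real.log 2) with hle | hle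
    · exact ⟨_, v₂, by linarith, by linarith⟩
    · exact ⟨_, v₁, by linarith, by linarith⟩

lemma exists_stable_span (x : ℕ → Fin (n + 1) → ℝ) (N : ℕ) :
    ∃ S : Submodule ℝ (Fin (n + 1) → ℝ), ∃ M, N ≤ M ∧
      ∀ k, M ≤ k → ∃ l, k ≤ l ∧ Submodule.span ℝ (x '' Set.Icc k l) = S := by
  let f : ℕ →o (Submodule ℝ (Fin (n + 1) → ℝ))ᵒᵈ :=
    ⟨fun k => OrderDual.toDual (Submodule.span ℝ (x '' Set.Ici k)), fun k l hkl =>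
      Submodule.span_mono (Set.image_mono (Set.Ici_subset_Ici.2 hkl))⟩
  obtain ⟨M, hM⟩ := IsArtinian.monotone_stabilizes f
  refine ⟨Submodule.span ℝ (x '' Set.Ici M), max N M, le_max_left _ _, fun k hk => ?_⟩
  have hSk : Submodule.span ℝ (x '' Set.Ici M) = Submodule.span ℝ (x '' Set.Ici k) :=
    hM k ((le_max_right _ _).trans hk)
  let g : ℕ →o Submodule ℝ (Fin (n + 1) → ℝ) :=
    ⟨fun l => Submodule.span ℝ (x '' Set.Icc k l), fun l l' hl =>
      Submodule.span_mono (Set.image_mono (Set.Icc_subset_Icc_right hl))⟩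
  obtain ⟨l, hl⟩ := monotone_stabilizes_iff_noetherian.2
    (inferInstance : IsNoetherian ℝ (Fin (n + 1) → ℝ)) g
  refine ⟨max k l, le_max_left _ _, ?_⟩
  rw [hSk]
  apply le_antisymm
  · exact Submodule.span_mono (Set.image_mono fun i hi => hi.1)
  · rw [Submodule.span_le]
    rintro _ ⟨i, hi, rfl⟩
    have h1 : g (max k l) = g (max i (max k l)) :=
      (hl _ (le_max_right _ _)).symm.trans (hl _ ((le_max_right k l).trans (le_max_right _ _)))
    change x i ∈ g (max k l)
    rw [h1]
    exact Submodule.subset_span (Set.mem_image_of_mem x ⟨hi, le_max_left _ _⟩)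

lemma le_geom_sum (h : ApproxSequence θ x b α G C₀ N) (hα : 1 ≤ α) (hG : 1 ≤ G) :
    α ≤ ∑ i ∈ Finset.range n, G ^ i := by
  by_contra! hlt
  have hα0 : 0 < α := by linarith
  obtain ⟨S, M, hNM, hS⟩ := exists_stable_span x N
  obtain ⟨l₀, hl₀, hSl₀⟩ := hS M le_rfl
  have hxS : x M ∈ S := by
    rw [← hSl₀]
    exact Submodule.subset_span (Set.mem_image_of_mem x ⟨le_rfl, hl₀⟩)
  have hx0 := h.apply_zero_ne_zero hNM
  obtain ⟨c, hc, hcv⟩ := exists_pos_le_of_hasVolumeBound θ hx0 S hxS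
  have hS0 : Module.finrank ℝ S ≠ 0 := by
    rw [Ne, Submodule.finrank_eq_zero]
    rintro rfl
    rw [Submodule.mem_bot] at hxS
    exact hx0 (by rw [hxS]; rfl)
  obtain ⟨j, hj⟩ := Nat.exists_eq_succ_of_ne_zero hS0
  have hjn : j ≤ n := by
    have := S.finrank_le
    simp at this
    omega
  have hsj : ∑ i ∈ Finset.range j, G ^ i < α :=
    (Finset.sum_le_sum_of_subset_of_nonneg (Finset.range_mono hjn)
      fun _ _ _ => by positivity).trans_lt hlt
  obtain ⟨C, hC⟩ := h.exists_hasVolumeBound hα hG j hsj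
  have hbound : ∀ k, M ≤ k → (α - ∑ i ∈ Finset.range j, G ^ i) / α * b k - C ≤ -Real.log c := by
    intro k hk
    obtain ⟨l, hkl, hl⟩ := hS k hk
    obtain ⟨d, hd, -, hdb⟩ := hC k l (hNM.trans hk) hkl (by rw [hl, hj])
    rw [hl] at hd
    have := hcv _ (by rw [hj]; exact hd)
    rw [← Real.log_le_iff_le_exp hc] at this
    linarith
  have hB : 0 < (α - ∑ i ∈ Finset.range j, G ^ i) / α := div_pos (by linarith) hα0
  have htend : Filter.Tendsto (fun k : ℕ => α * Real.log ((k : ℝ) + 1) - C₀)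
      Filter.atTop Filter.atTop := by
    refine Filter.tendsto_atTop_add_const_right _ _ (Filter.Tendsto.const_mul_atTop hα0 ?_)
    exact Real.tendsto_log_atTop.comp
      (Filter.tendsto_atTop_add_const_right _ _ tendsto_natCast_atTop_atTop)
  obtain ⟨k, hkM, hk⟩ := ((Filter.eventually_ge_atTop M).and (htend.eventually_gt_atTop
    ((C - Real.log c) / ((α - ∑ i ∈ Finset.range j, G ^ i) / α)))).exists
  have h1 := hbound k hkM
  have h2 := hk.trans_le (h.lower k (hNM.trans hkM))
  rw [div_lt_iff₀' hB] at h2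
  linarith

end ApproxSequence

lemma finite_setOf_iSup_abs_le {n : ℕ} (hn : 0 < n) (t : ℝ) :
    {q : Fin n → ℤ | (⨆ j, |(q j : ℝ)|) ≤ t}.Finite := by
  have : Nonempty (Fin n) := ⟨⟨0, hn⟩⟩
  refine (Set.finite_Icc (fun _ => -⌈t⌉ : Fin n → ℤ) (fun _ => ⌈t⌉)).subset fun q hq => ?_
  have hq' : ∀ j, |(q j : ℝ)| ≤ t := (ciSup_le_iff (Set.finite_range _).bddAbove).1 hq
  have h : ∀ j, |q j| ≤ ⌈t⌉ := fun j => by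
    have := (hq' j).trans (Int.le_ceil t)
    exact_mod_cast this
  exact ⟨fun j => (abs_le.1 (h j)).1, fun j => (abs_le.1 (h j)).2⟩

lemma phi_set_nonempty {n : ℕ} (hn : 0 < n) (θ : Fin n → ℝ) {t : ℝ} (ht : 1 ≤ t) :
    {v : ℝ | ∃ q : Fin n → ℤ, q ≠ 0 ∧ (⨆ j : Fin n, |(q j : ℝ)|) ≤ t ∧
      v = nint (∑ j : Fin n, (q j : ℝ) * θ j)}.Nonempty := by
  have : Nonempty (Fin n) := ⟨⟨0, hn⟩⟩
  refine ⟨_, fun _ => 1, fun h => ?_, ?_, rfl⟩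
  · exact one_ne_zero (congrFun h ⟨0, hn⟩)
  · exact ciSup_le fun j => by simpa using ht

lemma exists_phi_eq {n : ℕ} (hn : 0 < n) (θ : Fin n → ℝ) {t : ℝ} (ht : 1 ≤ t) :
    ∃ q : Fin n → ℤ, q ≠ 0 ∧ (∀ j, |(q j : ℝ)| ≤ t) ∧ phi θ t = nint (∑ j, (q j : ℝ) * θ j) := by
  have : Nonempty (Fin n) := ⟨⟨0, hn⟩⟩
  have hfin : {v : ℝ | ∃ q : Fin n → ℤ, q ≠ 0 ∧ (⨆ j : Fin n, |(q j : ℝ)|) ≤ t ∧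
      v = nint (∑ j : Fin n, (q j : ℝ) * θ j)}.Finite := by
    refine ((finite_setOf_iSup_abs_le hn t).image
      fun q => nint (∑ j : Fin n, (q j : ℝ) * θ j)).subset ?_
    rintro _ ⟨q, -, hq, rfl⟩
    exact ⟨q, hq, rfl⟩
  obtain ⟨q, hq0, hq, h⟩ := (phi_set_nonempty hn θ ht).csInf_mem hfin
  exact ⟨q, hq0, (ciSup_le_iff (Set.finite_range _).bddAbove).1 hq, h⟩

lemma phi_anti {n : ℕ} (hn : 0 < n) (θ : Fin n → ℝ) {s t : ℝ} (hs : 1 ≤ s) (hst : s ≤ t) :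
    phi θ t ≤ phi θ s := by
  refine csInf_le_csInf ⟨0, ?_⟩ (phi_set_nonempty hn θ hs) ?_
  · rintro _ ⟨q, -, -, rfl⟩
    exact abs_nonneg _
  · rintro _ ⟨q, hq0, hq, rfl⟩
    exact ⟨q, hq0, hq.trans hst, rfl⟩

lemma nint_pos_of_linearIndependent {n : ℕ} {θ : Fin n → ℝ}
    (hθ : LinearIndependent ℚ (Fin.cons (1 : ℝ) θ : Fin (n + 1) → ℝ)) {q : Fin n → ℤ}
    (hq : q ≠ 0) : 0 < nint (∑ j, (q j : ℝ) * θ j) := by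
  rw [nint, abs_pos]
  intro h
  apply hq
  rw [Fintype.linearIndependent_iff] at hθ
  have := hθ (Fin.cons (-(round (∑ j, (q j : ℝ) * θ j) : ℚ)) fun j => (q j : ℚ)) (by
    rw [Fin.sum_univ_succ]
    simp only [Fin.cons_zero, Fin.cons_succ, Rat.smul_def]
    push_cast
    linarith)
  ext j
  simpa using this j.succ

lemma exists_isFormPoint_abs_eq_phi {n : ℕ} (hn : 0 < n) {θ : Fin n → ℝ}
    (hθ : LinearIndependent ℚ (Fin.cons (1 : ℝ) θ : Fin (n + 1) → ℝ)) {t : ℝ} (ht : 1 ≤ t) :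
    ∃ x, IsFormPoint θ x ∧ |x 0| = phi θ t ∧ 0 < phi θ t ∧ ∀ i, i ≠ 0 → |x i| ≤ t := by
  obtain ⟨q, hq0, hq, h⟩ := exists_phi_eq hn θ ht
  refine ⟨_, ⟨-round (∑ j, (q j : ℝ) * θ j), q, rfl⟩, ?_, ?_, ?_⟩
  · rw [h, nint, Fin.cons_zero]
    congr 1
    push_cast
    ring
  · rw [h]
    exact nint_pos_of_linearIndependent hθ hq0
  · intro i
    refine Fin.cases (fun h => absurd rfl h) (fun j _ => ?_) i
    simpa using hq j

lemma exists_eventually_rpow_mul_phi_le {n : ℕ} {θ : Fin n → ℝ} {α : ℝ}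
    (h : ENNReal.ofReal α < omegaUnif θ) :
    ∃ w M : ℝ, α < w ∧ 0 < M ∧ ∀ᶠ t : ℝ in Filter.atTop, t ^ w * phi θ t ≤ M := by
  obtain ⟨_, ⟨w, hw, rfl, hlim⟩, hαw⟩ := lt_sSup_iff.1 h
  obtain ⟨c, hc, hctop⟩ := exists_between hlim
  refine ⟨w, c.toReal + 1, lt_of_not_ge fun h => hαw.not_ge (ENNReal.ofReal_le_ofReal h),
    by positivity, ?_⟩
  filter_upwards [Filter.eventually_lt_of_limsup_lt hc] with t ht
  have := (ENNReal.ofReal_le_iff_le_toReal hctop.ne).1 ht.le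
  linarith

lemma eventually_one_lt_rpow_mul_phi {n : ℕ} {θ : Fin n → ℝ} {β : ℝ} (hβ : 0 ≤ β)
    (h : omegaOrd θ < ENNReal.ofReal β) :
    ∀ᶠ t : ℝ in Filter.atTop, 1 < t ^ β * phi θ t := by
  have hlim : Filter.liminf (fun t : ℝ => ENNReal.ofReal (t ^ β * phi θ t)) Filter.atTop = ⊤ := by
    by_contra hne
    exact h.not_ge (le_sSup ⟨β, hβ, rfl, lt_top_iff_ne_top.2 hne⟩)
  have h1 : (1 : ℝ≥0∞) <
      Filter.liminf (fun t : ℝ => ENNReal.ofReal (t ^ β * phi θ t)) Filter.atTop := by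
    rw [hlim]
    exact ENNReal.one_lt_top
  filter_upwards [Filter.eventually_lt_of_lt_liminf h1] with t ht
  exact ENNReal.one_lt_ofReal.1 ht

lemma exists_approxSequence {n : ℕ} (hn : 0 < n) {θ : Fin n → ℝ}
    (hθ : LinearIndependent ℚ (Fin.cons (1 : ℝ) θ : Fin (n + 1) → ℝ)) {α G : ℝ} (hα : 0 < α)
    (hG : 0 ≤ G) (h₁ : ENNReal.ofReal α < omegaUnif θ)
    (h₂ : omegaOrd θ < ENNReal.ofReal (α * G)) :
    ∃ x b C₀ N, ApproxSequence θ x b α G C₀ N := by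
  obtain ⟨w, M, hw, hM, hwM⟩ := exists_eventually_rpow_mul_phi_le h₁
  have hβ := eventually_one_lt_rpow_mul_phi (by positivity) h₂
  obtain ⟨N, hN⟩ := Filter.eventually_atTop.1
    (tendsto_natCast_atTop_atTop.eventually (hwM.and hβ))
  have hx : ∀ k : ℕ, ∃ x, 1 ≤ k → IsFormPoint θ x ∧ |x 0| = phi θ k ∧ 0 < phi θ k ∧
      ∀ i, i ≠ 0 → |x i| ≤ k := by
    intro k
    by_cases hk : 1 ≤ k
    · obtain ⟨x, hx⟩ := exists_isFormPoint_abs_eq_phi hn hθ (t := k) (by exact_mod_cast hk)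
      exact ⟨x, fun _ => hx⟩
    · exact ⟨0, fun h => absurd h hk⟩
  choose x hx using hx
  refine ⟨x, fun k => -Real.log (phi θ k), Real.log M + α * Real.log 2, max 1 N,
    le_max_left _ _, ?_, ?_, ?_, ?_, ?_, ?_⟩
  · exact fun k hk => (hx k ((le_max_left _ _).trans hk)).1
  · intro k hk
    obtain ⟨-, h1, h2, -⟩ := hx k ((le_max_left _ _).trans hk)
    rw [h1, neg_neg, Real.exp_log h2]
  · intro k l hk hkl
    have hk1 : 1 ≤ k := (le_max_left _ _).trans hk
    exact neg_le_neg (Real.log_le_log (hx l (hk1.trans hkl)).2.2.1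
      (phi_anti hn θ (by exact_mod_cast hk1) (by exact_mod_cast hkl)))
  · exact fun k hk => (hx k ((le_max_left _ _).trans hk)).2.2.2
  · intro k hk
    have hk1 : 1 ≤ k := (le_max_left _ _).trans hk
    have hk1' : (1 : ℝ) ≤ k := by exact_mod_cast hk1
    have hpos := (hx k hk1).2.2.1
    have h := Real.log_le_log (by positivity) (hN k ((le_max_right _ _).trans hk)).1
    rw [Real.log_mul (by positivity) hpos.ne', Real.log_rpow (by positivity)] at h
    have h2 : Real.log ((k : ℝ) + 1) ≤ Real.log 2 + Real.log k := by
      rw [← Real.log_mul (by norm_num) (by positivity)]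
      exact Real.log_le_log (by positivity) (by linarith)
    have h3 : α * Real.log k ≤ w * Real.log k :=
      mul_le_mul_of_nonneg_right hw.le (Real.log_nonneg hk1')
    have h4 := mul_le_mul_of_nonneg_left h2 hα.le
    linarith
  · intro k hk
    have hk1 : 1 ≤ k := (le_max_left _ _).trans hk
    have hk1' : (1 : ℝ) ≤ k := by exact_mod_cast hk1
    have hpos := (hx k hk1).2.2.1
    have h := Real.log_pos (hN k ((le_max_right _ _).trans hk)).2
    rw [Real.log_mul (by positivity) hpos.ne', Real.log_rpow (by positivity)] at h
    linarith

lemma ApproxSequence.one_le_ratio {n : ℕ} {θ : Fin n → ℝ} {x : ℕ → Fin (n + 1) → ℝ} {b : ℕ → ℝ}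
    {α G C₀ : ℝ} {N : ℕ} (h : ApproxSequence θ x b α G C₀ N) (hα : 0 < α) : 1 ≤ G := by
  by_contra! hG
  have hpos : 0 < α * (1 - G) := mul_pos hα (by linarith)
  obtain ⟨k, hkN, hk⟩ := ((Filter.eventually_ge_atTop N).and
    ((Real.tendsto_log_atTop.comp tendsto_natCast_atTop_atTop).eventually_gt_atTop
      (C₀ / (α * (1 - G))))).exists
  have hk1 : (0 : ℝ) < k := by exact_mod_cast h.one_le.trans hkN
  have h1 := h.lower k hkN
  have h2 := h.upper k hkN
  have h3 : Real.log k ≤ Real.log ((k : ℝ) + 1) := Real.log_le_log hk1 (by linarith)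
  have h4 := mul_le_mul_of_nonneg_left h3 hα.le
  rw [Function.comp_apply, div_lt_iff₀' hpos] at hk
  linarith

lemma exists_lt_geom_sum_div_lt {n : ℕ} (hn : 2 ≤ n) {α₀ β g : ℝ} (hg : 0 < g) (hβ : 0 ≤ β)
    (hβg : β < α₀ * g) (hroot : ∑ i ∈ Finset.range n, g ^ i = α₀) :
    ∃ α, 1 < α ∧ α < α₀ ∧ ∑ i ∈ Finset.range n, (β / α) ^ i < α := by
  have hα₀ : 1 < α₀ := by
    have : ∑ i ∈ Finset.range 2, g ^ i ≤ ∑ i ∈ Finset.range n, g ^ i :=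
      Finset.sum_le_sum_of_subset_of_nonneg (Finset.range_mono hn) fun _ _ _ => by positivity
    simp only [Finset.sum_range_succ, Finset.sum_range_zero, pow_zero, pow_one] at this
    linarith
  have hlt : β / α₀ < g := by rwa [div_lt_iff₀' (by linarith)]
  have hsum : ∑ i ∈ Finset.range n, (β / α₀) ^ i < α₀ := by
    have h0 : 0 ≤ β / α₀ := by positivity
    refine lt_of_lt_of_eq (Finset.sum_lt_sum (fun i _ => pow_le_pow_left₀ h0 hlt.le i)
      ⟨1, Finset.mem_range.2 hn, ?_⟩) hroot
    simpa using hlt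
  have hcont : ContinuousAt (fun α : ℝ => ∑ i ∈ Finset.range n, (β / α) ^ i) α₀ := by
    have : α₀ ≠ 0 := by linarith
    fun_prop (disch := assumption)
  have hev : ∀ᶠ α in nhds α₀, 1 < α ∧ ∑ i ∈ Finset.range n, (β / α) ^ i < α :=
    (eventually_gt_nhds hα₀).and (hcont.eventually_lt continuousAt_id hsum)
  obtain ⟨α, ⟨h1, h2⟩, h3⟩ :=
    ((hev.filter_mono nhdsWithin_le_nhds).and (self_mem_nhdsWithin (s := Set.Iio α₀))).exists
  exact ⟨α, h1, h3, h2⟩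

/-- If `1, θ_1, …, θ_n` are `ℚ`-linearly independent and `ω̂(θ) < ∞`, then
`ω(θ) ≥ ω̂(θ) · G*(n, ω̂(θ))` where `G*(n, ω̂(θ))` is the unique positive root
of `R*_{n, ω̂(θ)}`. -/
theorem statement1 {n : ℕ} (hn : 2 ≤ n) (θ : Fin n → ℝ)
    (hθ : LinearIndependent ℚ (Fin.cons (1 : ℝ) θ : Fin (n + 1) → ℝ))
    (hhat : omegaUnif θ < ⊤) :
    ∀ g : ℝ, 0 < g → Rstar n (omegaUnif θ).toReal g = 0 →
      ENNReal.ofReal ((omegaUnif θ).toReal * g) ≤ omegaOrd θ := by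
  intro g hg hroot
  by_contra! hlt
  obtain ⟨β', hβ'₁, hβ'₂⟩ := exists_between hlt
  have hβ'top : β' ≠ ⊤ := (hβ'₂.trans ENNReal.ofReal_lt_top).ne
  have hβ₂ : β'.toReal < (omegaUnif θ).toReal * g := by
    rw [← ENNReal.ofReal_toReal hβ'top] at hβ'₂
    exact (ENNReal.ofReal_lt_ofReal_iff_of_nonneg ENNReal.toReal_nonneg).1 hβ'₂
  obtain ⟨α, hα1, hα, hsum⟩ := exists_lt_geom_sum_div_lt hn hg ENNReal.toReal_nonneg hβ₂
    (sub_eq_zero.1 hroot)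
  have hα0 : 0 < α := by linarith
  obtain ⟨x, b, C₀, N, h⟩ := exists_approxSequence (by omega) hθ hα0
    (G := β'.toReal / α) (by positivity)
    ((ENNReal.ofReal_lt_iff_lt_toReal hα0.le hhat.ne).2 hα)
    (by rwa [mul_div_cancel₀ _ hα0.ne', ENNReal.ofReal_toReal hβ'top])
  exact (h.le_geom_sum hα1.le (h.one_le_ratio hα0)).not_gt hsum

end
end

section
/- Let n ≥ 2 be an integer, let ω̂ be a real number with ω̂ ≥ n, and let C be a real number with C ≥ G*(n, ω̂). Then the set of points θ = (θ_1,…,θ_n) ∈ ℝ^n such that 1, θ_1, …, θ_n are linearly independent over ℚ, ω̂(θ) = ω̂, and ω(θ) = C·ω̂ is infinite. -/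
open scoped BigOperators ENNReal

noncomputable section

/-- Solutions of recurrences that express a term through the terms `n + 1` and `n` places before. -/
theorem exists_recurrence {α : Type*} {n : ℕ} (hn : 0 < n) (init : ℕ → α)
    (F : ℕ → α → α → α) :
    ∃ z : ℕ → α, (∀ i ≤ n, z i = init i) ∧ ∀ k, z (k + n + 1) = F k (z k) (z (k + 1)) := by
  let s : ℕ → ℕ → α := fun k => Nat.rec init
    (fun k w i => if i < n then w (i + 1) else F k (w 0) (w 1)) k
  have hs : ∀ k i, s (k + 1) i = if i < n then s k (i + 1) else F k (s k 0) (s k 1) :=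
    fun _ _ => rfl
  have shift : ∀ i ≤ n, ∀ k, s k i = s (k + i) 0 := by
    intro i
    induction i with
    | zero => intro _ k; rfl
    | succ i ih =>
      intro hi k
      have h := hs k i
      rw [if_pos (by omega)] at h
      rw [← h, ih (by omega) (k + 1), show k + 1 + i = k + (i + 1) by ring]
  refine ⟨fun k => s k 0, fun i hi => ?_, fun k => ?_⟩
  · have := shift i hi 0
    rw [Nat.zero_add] at this
    exact this.symm
  · have h := shift n le_rfl (k + 1)
    rw [hs k n, if_neg (lt_irrefl n), shift 1 hn k] at h
    rw [show k + n + 1 = k + 1 + n by ring]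
    exact h.symm

theorem exists_truncated_decreasing_solution (n N : ℕ) :
    ∀ a : ℕ → ℝ, (∀ k, 1 ≤ a k) → ∃ f : ℕ → ℝ, (∀ k, 0 ≤ f k) ∧ Antitone f ∧ 0 < f 0 ∧
      ∀ k < N, f k = a k * f (k + 1) + f (k + n + 1) := by
  induction N with
  | zero =>
    intro a _
    refine ⟨fun k => if k = 0 then 1 else 0, fun k => by positivity,
      antitone_nat_of_succ_le fun k => ?_, by simp, by simp⟩
    simp only [Nat.add_eq_zero_iff, one_ne_zero, and_false, if_false]
    positivity
  | succ N ih =>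
    intro a ha
    obtain ⟨f, hf, hanti, hpos, hrec⟩ := ih (fun k => a (k + 1)) fun k => ha _
    have h0 : f 0 ≤ a 0 * f 0 + f n := by nlinarith [ha 0, hf n, hf 0]
    refine ⟨fun k => Nat.casesOn k (a 0 * f 0 + f n) f, ?_, ?_, ?_, ?_⟩
    · rintro (_ | k)
      · exact (hf 0).trans h0
      · exact hf k
    · refine antitone_nat_of_succ_le ?_
      rintro (_ | k)
      · exact h0
      · exact hanti (Nat.le_succ k)
    · exact hpos.trans_le h0
    · rintro (_ | k) hk
      · simp
      · have := hrec k (by omega)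
        simpa [show k + 1 + n = k + n + 1 by ring] using this

/-- The recurrence `f k = a k * f (k + 1) + f (k + n + 1)` has a positive decreasing solution. -/
theorem exists_decreasing_solution (n : ℕ) (a : ℕ → ℝ) (ha : ∀ k, 1 ≤ a k) :
    ∃ f : ℕ → ℝ, f 0 = 1 ∧ (∀ k, 0 < f k) ∧ Antitone f ∧
      ∀ k, f k = a k * f (k + 1) + f (k + n + 1) := by
  let K : ℕ → Set (ℕ → ℝ) := fun N => {f | f ∈ Set.pi Set.univ (fun _ : ℕ => Set.Icc (0 : ℝ) 1) ∧
    f 0 = 1 ∧ ∀ k < N, f k = a k * f (k + 1) + f (k + n + 1)}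
  have hcpt : IsCompact (Set.pi Set.univ (fun _ : ℕ => Set.Icc (0 : ℝ) 1)) :=
    isCompact_univ_pi fun _ => isCompact_Icc
  have hclosed : ∀ N, IsClosed (K N) := by
    intro N
    have h : K N = Set.pi Set.univ (fun _ : ℕ => Set.Icc (0 : ℝ) 1) ∩ ({f | f 0 = 1} ∩
        ⋂ k, ⋂ _ : k < N, {f : ℕ → ℝ | f k = a k * f (k + 1) + f (k + n + 1)}) := by
      ext f
      simp [K]
    rw [h]
    refine hcpt.isClosed.inter (IsClosed.inter (isClosed_eq (by fun_prop) (by fun_prop)) ?_)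
    exact isClosed_iInter fun k => isClosed_iInter fun _ =>
      isClosed_eq (by fun_prop) (by fun_prop)
  have hne : ∀ N, (K N).Nonempty := by
    intro N
    obtain ⟨f, hf, hanti, hpos, hrec⟩ := exists_truncated_decreasing_solution n N a ha
    refine ⟨fun k => f k / f 0, fun k _ => ⟨?_, ?_⟩, div_self hpos.ne', fun k hk => ?_⟩
    · exact div_nonneg (hf k) hpos.le
    · exact (div_le_one hpos).2 (hanti (Nat.zero_le k))
    · simp only
      rw [hrec k hk]
      ring
  obtain ⟨f, hf⟩ := IsCompact.nonempty_iInter_of_sequence_nonempty_isCompact_isClosed K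
    (fun N f hf => ⟨hf.1, hf.2.1, fun k hk => hf.2.2 k (by omega)⟩) hne
    (hcpt.of_isClosed_subset (hclosed 0) fun f hf => hf.1) hclosed
  rw [Set.mem_iInter] at hf
  have hnn : ∀ k, 0 ≤ f k := fun k => ((hf 0).1 k trivial).1
  have hrec : ∀ k, f k = a k * f (k + 1) + f (k + n + 1) := fun k =>
    (hf (k + 1)).2.2 k (Nat.lt_succ_self k)
  have hanti : Antitone f := antitone_nat_of_succ_le fun k => by
    nlinarith [hrec k, hnn (k + 1), hnn (k + n + 1), ha k]
  refine ⟨f, (hf 0).2.1, fun k => ?_, hanti, hrec⟩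
  induction k with
  | zero => rw [(hf 0).2.1]; exact one_pos
  | succ k ih =>
    by_contra h
    have h1 : f (k + 1) = 0 := le_antisymm (not_lt.1 h) (hnn _)
    have h2 : f (k + n + 1) ≤ f (k + 1) := hanti (by omega)
    have h3 := hrec k
    rw [h1] at h2 h3
    linarith

theorem exists_intCoeff_eq_sum {M : Type*} [AddCommGroup M] {n : ℕ} (hn : 0 < n) {a : ℕ → ℤ}
    {z : ℕ → M} (hz : ∀ k, z (k + n + 1) = z k - a k • z (k + 1))
    (h0 : ∀ w, ∃ c : ℕ → ℤ, w = ∑ i ∈ Finset.range (n + 1), c i • z i) (k : ℕ) :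
    ∀ w, ∃ c : ℕ → ℤ, w = ∑ i ∈ Finset.range (n + 1), c i • z (k + i) := by
  induction k with
  | zero => simpa using h0
  | succ k ih =>
    intro w
    obtain ⟨c, hc⟩ := ih w
    obtain ⟨m, rfl⟩ : ∃ m, n = m + 1 := ⟨n - 1, by omega⟩
    refine ⟨fun i => if i = 0 then c 1 + a k * c 0 else if i = m + 1 then c 0 else c (i + 1), ?_⟩
    have hk : z k = z (k + (m + 1) + 1) + a k • z (k + 1) := by rw [hz k]; abel
    have hmid : ∀ i ∈ Finset.range m,
        (if i + 1 = 0 then c 1 + a k * c 0 else if i + 1 = m + 1 then c 0 else c (i + 1 + 1)) •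
          z (k + 1 + (i + 1)) = c (i + 1 + 1) • z (k + (i + 1 + 1)) := by
      intro i hi
      have := Finset.mem_range.1 hi
      rw [if_neg (by omega), if_neg (by omega), show k + 1 + (i + 1) = k + (i + 1 + 1) by ring]
    rw [Finset.sum_range_succ, Finset.sum_range_succ', Finset.sum_congr rfl hmid, hc,
      Finset.sum_range_succ', Finset.sum_range_succ']
    simp only [if_true, Nat.add_eq_zero_iff, one_ne_zero, and_false, if_false, add_zero, zero_add]
    rw [hk, show k + 1 + (m + 1) = k + (m + 1) + 1 by ring, smul_add, add_smul, smul_smul,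
      mul_comm (c 0)]
    abel

theorem recurrence_induction {n : ℕ} (hn : 0 < n) {P : ℕ → Prop} (h0 : ∀ i ≤ n, P i)
    (h : ∀ k, P k → P (k + 1) → P (k + n + 1)) (k : ℕ) : P k := by
  induction k using Nat.strong_induction_on with
  | _ k ih =>
    by_cases hk : k ≤ n
    · exact h0 k hk
    · obtain ⟨m, rfl⟩ : ∃ m, k = m + n + 1 := ⟨k - n - 1, by omega⟩
      exact h m (ih m (by omega)) (ih (m + 1) (by omega))

theorem abs_sub_axis_le {n : ℕ} (hn : 0 < n) {a Y : ℕ → ℝ} {q : ℕ → Fin n → ℝ}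
    (ha : ∀ k, 0 < a k) (hsum : ∀ k, ∑ i ∈ Finset.range k, 2 / a i ≤ 1)
    (hq0 : ∀ i ≤ n, ∀ j, q i j = if i % n = j then Y i else 0)
    (hq : ∀ k j, q (k + n + 1) j = q k j - a k * q (k + 1) j)
    (hY : ∀ k, Y (k + n + 1) = -(a k * Y (k + 1))) (hmono : Monotone fun k => |Y k|) (k : ℕ) :
    ∀ j, |q k j - if k % n = j then Y k else 0| ≤
      (∑ i ∈ Finset.range (k - 1), 2 / a i) * |Y k| := by
  have hnn : ∀ k, 0 ≤ ∑ i ∈ Finset.range k, 2 / a i := fun k =>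
    Finset.sum_nonneg fun i _ => (div_pos two_pos (ha i)).le
  refine recurrence_induction hn (P := fun k => ∀ j, |q k j - if k % n = j then Y k else 0| ≤
      (∑ i ∈ Finset.range (k - 1), 2 / a i) * |Y k|) (fun i hi j => ?_) (fun k h1 h2 j => ?_) k
  · rw [hq0 i hi j, sub_self, abs_zero]
    exact mul_nonneg (hnn _) (abs_nonneg _)
  · have e1 : (k + n + 1) % n = (k + 1) % n := by
      rw [show k + n + 1 = k + 1 + n by ring, Nat.add_mod_right]
    have e2 : (q (k + n + 1) j - if (k + n + 1) % n = j then Y (k + n + 1) else 0) =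
        q k j - a k * (q (k + 1) j - if (k + 1) % n = j then Y (k + 1) else 0) := by
      rw [e1, hq, hY]
      split_ifs <;> ring
    have e3 : |Y (k + n + 1)| = a k * |Y (k + 1)| := by
      rw [hY, abs_neg, abs_mul, abs_of_pos (ha k)]
    have h3 : |q k j| ≤ 2 * |Y k| := by
      have h4 := h1 j
      have h5 : |if k % n = j then Y k else 0| ≤ |Y k| := by
        split_ifs
        · exact le_rfl
        · simp
      have h6 := abs_add_le (q k j - if k % n = j then Y k else 0) (if k % n = j then Y k else 0)
      rw [sub_add_cancel] at h6
      nlinarith [hsum (k - 1), abs_nonneg (Y k)]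
    have h4 : |Y k| ≤ |Y (k + 1)| := hmono (Nat.le_succ k)
    have h5 : ∑ i ∈ Finset.range (k + 1), 2 / a i ≤
        ∑ i ∈ Finset.range (k + n + 1 - 1), 2 / a i :=
      Finset.sum_le_sum_of_subset_of_nonneg (Finset.range_subset_range.2 (by omega))
        fun i _ _ => (div_pos two_pos (ha i)).le
    rw [Finset.sum_range_succ] at h5
    have h7 := mul_le_mul_of_nonneg_right h5 (abs_nonneg (Y (k + n + 1)))
    refine le_trans ?_ h7
    have h8 := h2 j
    rw [Nat.add_sub_cancel] at h8
    rw [e2, e3]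
    calc _ ≤ |q k j| + |a k * (q (k + 1) j - if (k + 1) % n = j then Y (k + 1) else 0)| :=
          abs_sub _ _
      _ ≤ 2 * |Y (k + 1)| + a k * ((∑ i ∈ Finset.range k, 2 / a i) * |Y (k + 1)|) := by
          rw [abs_mul, abs_of_pos (ha k)]
          have := mul_le_mul_of_nonneg_left h8 (ha k).le
          linarith
      _ = _ := by
          have := (ha k).ne'
          field_simp
          ring

theorem abs_coeff_mul_le {n : ℕ} {Y : ℕ → ℝ} {q : ℕ → Fin n → ℝ} {ε : ℝ}
    (hε0 : 0 ≤ ε) (hε : n * ε ≤ 1 / 4)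
    (hq : ∀ k j, |q k j - if k % n = j then Y k else 0| ≤ ε * |Y k|) (k : ℕ) (c : ℕ → ℝ) {B : ℝ}
    (hB : ∀ j, |∑ i ∈ Finset.range n, c i * q (k + i) j| ≤ B) :
    ∀ i < n, |c i| * |Y (k + i)| ≤ 4 / 3 * B := by
  intro i hi
  have hn : 0 < n := by omega
  obtain ⟨m, hm, hmax⟩ := Finset.exists_max_image (Finset.range n)
    (fun i => |c i| * |Y (k + i)|) ⟨0, Finset.mem_range.2 hn⟩
  refine (hmax i (Finset.mem_range.2 hi)).trans ?_
  set M := |c m| * |Y (k + m)| with hM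
  have hmn := Finset.mem_range.1 hm
  let j : Fin n := ⟨(k + m) % n, Nat.mod_lt _ hn⟩
  have hmain : ∑ i ∈ Finset.range n, c i * (if (k + i) % n = j then Y (k + i) else 0) =
      c m * Y (k + m) := by
    rw [Finset.sum_eq_single m]
    · simp [j]
    · intro i hi hne
      rw [if_neg, mul_zero]
      intro h
      have h2 : i ≡ m [MOD n] := Nat.ModEq.add_left_cancel' k h
      exact hne (h2.eq_of_lt_of_lt (Finset.mem_range.1 hi) hmn)
    · exact fun h => absurd hm h
  have herr : |∑ i ∈ Finset.range n, c i * (q (k + i) j -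
      if (k + i) % n = j then Y (k + i) else 0)| ≤ M / 4 := by
    refine (Finset.abs_sum_le_sum_abs _ _).trans ?_
    have hterm : ∀ i ∈ Finset.range n, |c i * (q (k + i) j -
        if (k + i) % n = j then Y (k + i) else 0)| ≤ ε * M := by
      intro i hi
      rw [abs_mul]
      have h1 := mul_le_mul_of_nonneg_left (hq (k + i) j) (abs_nonneg (c i))
      have h2 := hmax i hi
      nlinarith
    refine (Finset.sum_le_card_nsmul _ _ _ hterm).trans ?_
    rw [Finset.card_range, nsmul_eq_mul]
    have : 0 ≤ M := by positivity
    nlinarith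
  have hsplit : ∑ i ∈ Finset.range n, c i * q (k + i) j = c m * Y (k + m) +
      ∑ i ∈ Finset.range n, c i * (q (k + i) j - if (k + i) % n = j then Y (k + i) else 0) := by
    rw [← hmain, ← Finset.sum_add_distrib]
    exact Finset.sum_congr rfl fun i _ => by ring
  have h1 := hB j
  have h2 : M = |c m * Y (k + m)| := by rw [abs_mul]
  have h3 : c m * Y (k + m) = ∑ i ∈ Finset.range n, c i * q (k + i) j -
      ∑ i ∈ Finset.range n, c i * (q (k + i) j - if (k + i) % n = j then Y (k + i) else 0) := by
    rw [hsplit]; ring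
  have h4 := abs_sub (∑ i ∈ Finset.range n, c i * q (k + i) j)
    (∑ i ∈ Finset.range n, c i * (q (k + i) j - if (k + i) % n = j then Y (k + i) else 0))
  rw [← h3, ← h2] at h4
  linarith

theorem decreasing_solution_bounds {n : ℕ} {a X f : ℕ → ℝ} (ha : ∀ k, 1 ≤ a k)
    (hX1 : ∀ i < n, X (i + 1) = 1) (hpos : ∀ k, 0 < X (k + 1))
    (hX : ∀ k, X (k + n + 1) = a k * X (k + 1))
    (hf0 : f 0 = 1) (hfpos : ∀ k, 0 < f k) (hanti : Antitone f)
    (hf : ∀ k, f k = a k * f (k + 1) + f (k + n + 1)) (k : ℕ) :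
    1 - ∑ i ∈ Finset.range k, 1 / a i ≤ f k * ∏ i ∈ Finset.range n, X (k + 1 + i) ∧
      f k * ∏ i ∈ Finset.range n, X (k + 1 + i) ≤ 1 := by
  have hP : ∀ k, ∏ i ∈ Finset.range n, X (k + 1 + 1 + i) =
      a k * ∏ i ∈ Finset.range n, X (k + 1 + i) := by
    intro k
    have h1 := Finset.prod_range_succ (fun i => X (k + 1 + i)) n
    have h2 := Finset.prod_range_succ' (fun i => X (k + 1 + i)) n
    rw [h1] at h2
    have h3 : X (k + 1 + n) = a k * X (k + 1) := by rw [← hX k]; congr 1; ring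
    simp only [add_zero] at h2
    rw [h3] at h2
    have h4 : ∀ i, k + 1 + 1 + i = k + 1 + (i + 1) := fun i => by ring
    simp only [h4]
    have := (hpos k).ne'
    apply mul_right_cancel₀ this
    rw [← h2]
    ring
  have hPpos : ∀ k, 0 < ∏ i ∈ Finset.range n, X (k + 1 + i) := fun k =>
    Finset.prod_pos fun i _ => by rw [show k + 1 + i = k + i + 1 by ring]; exact hpos _
  induction k with
  | zero =>
    have : ∏ i ∈ Finset.range n, X (0 + 1 + i) = 1 :=
      Finset.prod_eq_one fun i hi => by
        rw [show 0 + 1 + i = i + 1 by ring]; exact hX1 i (Finset.mem_range.1 hi)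
    rw [this, hf0]
    simp
  | succ k ih =>
    rw [hP, Finset.sum_range_succ]
    set P := ∏ i ∈ Finset.range n, X (k + 1 + i)
    have hPk : 0 < P := hPpos k
    have hak := ha k
    have e : f (k + 1) * (a k * P) = f k * P - f (k + n + 1) * P := by rw [hf k]; ring
    have h1 := mul_pos (hfpos (k + n + 1)) hPk
    have h2 : f (k + n + 1) * P ≤ f (k + 1) * P :=
      mul_le_mul_of_nonneg_right (hanti (by omega)) hPk.le
    have h3 : f (k + 1) * P ≤ 1 / a k := by
      rw [le_div_iff₀ (by linarith), mul_assoc, mul_comm P]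
      linarith [ih.2]
    constructor <;> linarith [ih.1, ih.2]

theorem sum_range_le_of_geometric {n : ℕ} (hn : 0 < n) {a : ℕ → ℝ}
    (ha : ∀ k, 16 * n * 2 ^ k ≤ a k) (k : ℕ) :
    ∑ i ∈ Finset.range k, 2 / a i ≤ 1 / (4 * n) := by
  have hn' : (0 : ℝ) < n := by exact_mod_cast hn
  calc ∑ i ∈ Finset.range k, 2 / a i
      ≤ ∑ i ∈ Finset.range k, 1 / (8 * n) * (1 / (2 : ℝ)) ^ i := by
        refine Finset.sum_le_sum fun i _ => ?_
        have h : 2 / a i ≤ 2 / (16 * n * 2 ^ i) :=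
          div_le_div_of_nonneg_left (by norm_num) (by positivity) (ha i)
        refine h.trans (le_of_eq ?_)
        rw [one_div_pow]
        field_simp
        norm_num
    _ ≤ 1 / (8 * n) * 2 := by
        rw [← Finset.mul_sum]
        exact mul_le_mul_of_nonneg_left (sum_geometric_two_le k) (by positivity)
    _ = _ := by field_simp; norm_num

theorem exists_sum_eq_of_axis {n : ℕ} (hn : 0 < n) {z : ℕ → (Fin n → ℤ) × ℤ}
    (hz0 : z 0 = (0, 1))
    (hz1 : ∀ i < n, z (i + 1) = (fun j : Fin n => if (i + 1) % n = j then 1 else 0, 0))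
    (w : (Fin n → ℤ) × ℤ) :
    ∃ c : ℕ → ℤ, w = ∑ i ∈ Finset.range (n + 1), c i • z i := by
  refine ⟨fun i => if i = 0 then w.2 else w.1 ⟨i % n, Nat.mod_lt _ hn⟩, ?_⟩
  rw [Finset.sum_range_succ']
  simp only [Nat.add_eq_zero_iff, one_ne_zero, and_false, if_false, if_true]
  rw [Finset.sum_congr rfl fun i hi => by rw [hz1 i (Finset.mem_range.1 hi)], hz0]
  refine Prod.ext ?_ ?_
  · funext j
    simp only [Prod.fst_add, Prod.fst_sum, Prod.smul_mk, Pi.add_apply, Finset.sum_apply,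
      Pi.smul_apply, smul_zero, add_zero, smul_eq_mul, Pi.zero_apply]
    obtain ⟨i, hi, hij⟩ : ∃ i < n, (i + 1) % n = j := by
      rcases Nat.eq_zero_or_pos (j : ℕ) with h | h
      · exact ⟨n - 1, by omega, by rw [Nat.sub_add_cancel hn, Nat.mod_self, h]⟩
      · exact ⟨j - 1, by omega, by rw [Nat.sub_add_cancel h, Nat.mod_eq_of_lt j.2]⟩
    rw [Finset.sum_eq_single i]
    · have : (⟨(i + 1) % n, Nat.mod_lt _ hn⟩ : Fin n) = j := Fin.ext hij
      rw [this, if_pos hij, mul_one]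
    · intro m hm hne
      rw [if_neg, mul_zero]
      intro h
      have h2 : m + 1 ≡ i + 1 [MOD n] := h.trans hij.symm
      exact hne ((Nat.ModEq.add_right_cancel' 1 h2).eq_of_lt_of_lt (Finset.mem_range.1 hm) hi)
    · exact fun h => absurd (Finset.mem_range.2 hi) h
  · simp [Prod.snd_sum]

/-- A linear form whose sequence of best approximations has prescribed heights `X k`. -/
theorem exists_linear_form_with_heights {n : ℕ} (hn : 0 < n) {a X : ℕ → ℕ}
    (ha : ∀ k, 16 * n * 2 ^ k ≤ a k) (hX0 : X 0 = 0) (hX1 : ∀ i < n, X (i + 1) = 1)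
    (hX : ∀ k, X (k + n + 1) = a k * X (k + 1)) (hmono : Monotone X) :
    ∃ θ : Fin n → ℝ,
      (∀ k, ∃ q : Fin n → ℤ, ∃ p : ℤ, q ≠ 0 ∧ (∀ j, |(q j : ℝ)| ≤ 2 * X (k + 1)) ∧
        |∑ j, (q j : ℝ) * θ j + p| ≤ (∏ i ∈ Finset.range n, (X (k + 1 + 1 + i) : ℝ))⁻¹) ∧
      ∀ (k : ℕ) (q : Fin n → ℤ) (p : ℤ), q ≠ 0 → (∀ j, |(q j : ℝ)| ≤ X (k + 1) / 2) →
        (∏ i ∈ Finset.range n, (X (k + 1 + i) : ℝ))⁻¹ / 4 ≤ |∑ j, (q j : ℝ) * θ j + p| := by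
  have hn' : (1 : ℝ) ≤ n := by exact_mod_cast hn
  have haR : ∀ k, 16 * (n : ℝ) * 2 ^ k ≤ a k := fun k => by exact_mod_cast ha k
  have ha16 : ∀ k, 16 * (n : ℝ) ≤ a k := fun k => by
    have h1 : (1 : ℝ) ≤ 2 ^ k := one_le_pow₀ (by norm_num)
    nlinarith [haR k]
  have ha1 : ∀ k, (1 : ℝ) ≤ a k := fun k => by linarith [ha16 k]
  have hapos : ∀ k, (0 : ℝ) < a k := fun k => one_pos.trans_le (ha1 k)
  have hsum := sum_range_le_of_geometric hn haR
  have hε4 : (1 : ℝ) / (4 * n) ≤ 1 / 4 :=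
    div_le_div_of_nonneg_left (by norm_num) (by norm_num) (by linarith)
  have hXpos : ∀ k, 0 < X (k + 1) := fun k => by
    have h1 := hmono (show 0 + 1 ≤ k + 1 by omega)
    rw [hX1 0 hn] at h1
    exact h1
  have hXposR : ∀ k, (0 : ℝ) < X (k + 1) := fun k => by exact_mod_cast hXpos k
  obtain ⟨f, hf0, hfpos, hanti, hf⟩ := exists_decreasing_solution n (fun k => (a k : ℝ)) ha1
  have hbd := decreasing_solution_bounds (n := n) (a := fun k => (a k : ℝ))
    (X := fun k => (X k : ℝ)) ha1 (fun i hi => by exact_mod_cast hX1 i hi) hXposR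
    (fun k => by exact_mod_cast hX k) hf0 hfpos hanti hf
  have hPpos : ∀ k, 0 < ∏ i ∈ Finset.range n, (X (k + 1 + i) : ℝ) := fun k =>
    Finset.prod_pos fun i _ => by rw [show k + 1 + i = k + i + 1 by ring]; exact hXposR _
  have hfle : ∀ k, f k ≤ (∏ i ∈ Finset.range n, (X (k + 1 + i) : ℝ))⁻¹ := fun k => by
    rw [← one_div, le_div_iff₀ (hPpos k)]
    exact (hbd k).2
  have hfge : ∀ k, (∏ i ∈ Finset.range n, (X (k + 1 + i) : ℝ))⁻¹ / 2 ≤ f k := fun k => by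
    have h1 := (hbd k).1
    have h2 := hsum k
    have h3 : ∑ i ∈ Finset.range k, 2 / (a i : ℝ) = 2 * ∑ i ∈ Finset.range k, 1 / (a i : ℝ) := by
      rw [Finset.mul_sum]
      exact Finset.sum_congr rfl fun i _ => by ring
    rw [div_le_iff₀ two_pos, inv_le_iff_one_le_mul₀ (hPpos k)]
    nlinarith
  obtain ⟨z, hz0, hz⟩ := exists_recurrence hn
    (fun i => if i = 0 then ((0 : Fin n → ℤ), (1 : ℤ))
      else (fun j => if i % n = j then 1 else 0, 0))
    (fun k (u v : (Fin n → ℤ) × ℤ) => u - (a k : ℤ) • v)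
  obtain ⟨Y, hY0, hY⟩ := exists_recurrence hn (fun i => if i = 0 then (0 : ℝ) else 1)
    (fun k _ v => -((a k : ℝ) * v))
  have hYX : ∀ k, |Y k| = X k := by
    refine recurrence_induction hn (fun i hi => ?_) fun k _ h => ?_
    · rw [hY0 i hi]
      rcases i with _ | i
      · simp [hX0]
      · simp [hX1 i (by omega)]
    · rw [hY, abs_neg, abs_mul, abs_of_pos (hapos k), h, hX k]
      push_cast
      rfl
  have hYmono : Monotone fun k => |Y k| := fun i j hij => by
    simp only [hYX]
    exact_mod_cast hmono hij
  let Q : ℕ → Fin n → ℝ := fun k j => ((z k).1 j : ℝ)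
  have hQ : ∀ k j, |Q k j - if k % n = j then Y k else 0| ≤ 1 / (4 * n) * |Y k| := by
    intro k j
    refine (abs_sub_axis_le hn hapos (fun k => (hsum k).trans (hε4.trans (by norm_num)))
      (fun i hi j => ?_) (fun k j => ?_) hY hYmono k j).trans
        (mul_le_mul_of_nonneg_right (hsum _) (abs_nonneg _))
    · simp only [Q, hz0 i hi, hY0 i hi]
      split_ifs with h1 h2 <;> simp [*]
    · simp [Q, hz k]
  have hQle : ∀ k j, |Q k j| ≤ 2 * X k := by
    intro k j
    have h4 := hQ k j
    have h5 : |if k % n = j then Y k else 0| ≤ |Y k| := by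
      split_ifs
      · exact le_rfl
      · simp
    have h6 := abs_add_le (Q k j - if k % n = j then Y k else 0) (if k % n = j then Y k else 0)
    rw [sub_add_cancel] at h6
    rw [hYX] at h4 h5
    have : (0 : ℝ) ≤ X k := Nat.cast_nonneg _
    nlinarith
  let θ : Fin n → ℝ := fun j => if (j : ℕ) = 0 then f n else f j
  let L : (Fin n → ℤ) × ℤ → ℝ := fun w => ∑ j, (w.1 j : ℝ) * θ j + w.2
  have hLsub : ∀ (u v : (Fin n → ℤ) × ℤ) (m : ℤ), L (u - m • v) = L u - m * L v := by
    intro u v m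
    simp only [L, Prod.fst_sub, Prod.snd_sub, Prod.smul_fst, Prod.smul_snd, Pi.sub_apply,
      Pi.smul_apply, smul_eq_mul]
    push_cast
    simp only [sub_mul, Finset.sum_sub_distrib, mul_add, Finset.mul_sum, mul_assoc]
    ring
  have hLsum : ∀ (s : Finset ℕ) (c : ℕ → ℤ) (v : ℕ → (Fin n → ℤ) × ℤ),
      L (∑ i ∈ s, c i • v i) = ∑ i ∈ s, (c i : ℝ) * L (v i) := by
    intro s c v
    induction s using Finset.induction_on with
    | empty => simp [L]
    | insert i s hi ih =>
      rw [Finset.sum_insert hi, Finset.sum_insert hi, ← ih, add_comm,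
        show ∑ i ∈ s, c i • v i + c i • v i = ∑ i ∈ s, c i • v i - (-c i) • v i by
          rw [neg_smul, sub_neg_eq_add], hLsub]
      push_cast
      ring
  have hLz : ∀ k, L (z k) = f k := by
    refine recurrence_induction hn (fun i hi => ?_) fun k h1 h2 => ?_
    · rw [hz0 i hi]
      split_ifs with h
      · simp [L, h, hf0]
      · simp only [L, Int.cast_zero, add_zero, Int.cast_ite, Int.cast_one, ite_mul, one_mul,
          zero_mul]
        rw [Finset.sum_eq_single (⟨i % n, Nat.mod_lt _ hn⟩ : Fin n)]
        · simp only [if_true, θ]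
          rcases hi.eq_or_lt with rfl | h3
          · rw [Nat.mod_self, if_pos rfl]
          · rw [Nat.mod_eq_of_lt h3, if_neg h]
        · intro j _ hj
          rw [if_neg fun h4 => hj (Fin.ext h4.symm)]
        · simp
    · rw [hz, hLsub, h1, h2, hf k]
      push_cast
      ring
  have hspan := exists_intCoeff_eq_sum hn (a := fun k => (a k : ℤ)) hz
    (exists_sum_eq_of_axis hn (by rw [hz0 0 (Nat.zero_le n), if_pos rfl])
      fun i hi => by rw [hz0 (i + 1) hi, if_neg (by omega)])
  refine ⟨θ, fun k => ⟨(z (k + 1)).1, (z (k + 1)).2, fun h => ?_, hQle (k + 1), ?_⟩,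
    fun k q p hq hqX => ?_⟩
  · have h1 := hQ (k + 1) ⟨(k + 1) % n, Nat.mod_lt _ hn⟩
    simp only [Q, h, if_true, Pi.zero_apply, Int.cast_zero, zero_sub, abs_neg, hYX] at h1
    nlinarith [hXposR k]
  · change |L (z (k + 1))| ≤ _
    rw [hLz, abs_of_pos (hfpos _)]
    exact hfle _
  · change _ ≤ |L (q, p)|
    obtain ⟨c, hc⟩ := hspan k (q, p)
    rw [Finset.sum_range_succ'] at hc
    have hcq : ∀ j, (q j : ℝ) - c 0 * Q k j =
        ∑ i ∈ Finset.range n, (c (i + 1) : ℝ) * Q (k + 1 + i) j := by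
      intro j
      have h1 := congrArg (fun w : (Fin n → ℤ) × ℤ => (w.1 j : ℝ)) hc
      simp only [Prod.fst_add, Prod.fst_sum, Prod.smul_fst, Pi.add_apply, Finset.sum_apply,
        Pi.smul_apply, smul_eq_mul, add_zero] at h1
      push_cast at h1
      rw [h1, add_sub_cancel_right]
      exact Finset.sum_congr rfl fun i _ => by rw [show k + 1 + i = k + (i + 1) by ring]
    have hX1k := hXposR k
    have hXk : (X k : ℝ) ≤ X (k + 1) := by exact_mod_cast hmono (Nat.le_succ k)
    have hB : ∀ j, |∑ i ∈ Finset.range n, (c (i + 1) : ℝ) * Q (k + 1 + i) j| ≤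
        X (k + 1) / 2 + 2 * |(c 0 : ℝ)| * X (k + 1) := by
      intro j
      rw [← hcq]
      refine (abs_sub _ _).trans (add_le_add (hqX j) ?_)
      rw [abs_mul]
      nlinarith [hQle k j, abs_nonneg (c 0 : ℝ)]
    have hcoef := abs_coeff_mul_le (by positivity) (by field_simp; exact le_rfl) hQ (k + 1)
      (fun i => (c (i + 1) : ℝ)) hB
    have hYge : ∀ i, (X (k + 1) : ℝ) ≤ |Y (k + 1 + i)| := fun i => by
      rw [hYX]
      exact_mod_cast hmono (Nat.le_add_right _ _)
    have hcle : ∀ i < n, |(c (i + 1) : ℝ)| ≤ 4 / 3 * (1 / 2 + 2 * |(c 0 : ℝ)|) := by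
      intro i hi
      have h1 := hcoef i hi
      have h2 := mul_le_mul_of_nonneg_left (hYge i) (abs_nonneg (c (i + 1) : ℝ))
      refine le_of_mul_le_mul_right ?_ hX1k
      linarith
    have hc0 : 1 ≤ |(c 0 : ℝ)| := by
      by_contra h
      have h0 : c 0 = 0 := by
        by_contra h1
        exact h (by exact_mod_cast Int.one_le_abs h1)
      have hci : ∀ i < n, c (i + 1) = 0 := by
        intro i hi
        by_contra h1
        have h2 : (1 : ℝ) ≤ |(c (i + 1) : ℝ)| := by exact_mod_cast Int.one_le_abs h1
        have h3 := hcle i hi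
        rw [h0] at h3
        norm_num at h3
        linarith
      refine hq (funext fun j => ?_)
      have h1 := hcq j
      rw [h0, Finset.sum_eq_zero fun i hi => by rw [hci i (Finset.mem_range.1 hi)]; simp] at h1
      simpa using h1
    have hL : L (q, p) = ∑ i ∈ Finset.range n, (c (i + 1) : ℝ) * f (k + (i + 1)) + c 0 * f k := by
      rw [hc, ← Finset.sum_range_succ' (fun i => c i • z (k + i)), hLsum, Finset.sum_range_succ']
      simp only [hLz, add_zero]
    have hsmall : |∑ i ∈ Finset.range n, (c (i + 1) : ℝ) * f (k + (i + 1))| ≤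
        |(c 0 : ℝ)| * f k / 4 := by
      have h1 : ∀ i ∈ Finset.range n, |(c (i + 1) : ℝ) * f (k + (i + 1))| ≤
          4 * |(c 0 : ℝ)| * f (k + 1) := by
        intro i hi
        rw [abs_mul, abs_of_pos (hfpos _)]
        refine mul_le_mul ?_ (hanti (by omega)) (hfpos _).le (by positivity)
        linarith [hcle i (Finset.mem_range.1 hi)]
      refine (Finset.abs_sum_le_sum_abs _ _).trans ((Finset.sum_le_card_nsmul _ _ _ h1).trans ?_)
      rw [Finset.card_range, nsmul_eq_mul]
      have h2 : 16 * (n : ℝ) * f (k + 1) ≤ f k := by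
        have h3 := hf k
        have h4 := mul_le_mul_of_nonneg_right (ha16 k) (hfpos (k + 1)).le
        have h5 := hfpos (k + n + 1)
        linarith
      nlinarith
    have htri := abs_sub_abs_le_abs_add ((c 0 : ℝ) * f k)
      (∑ i ∈ Finset.range n, (c (i + 1) : ℝ) * f (k + (i + 1)))
    rw [add_comm, ← hL, abs_mul, abs_of_pos (hfpos k)] at htri
    have h1 := hfge k
    have h2 := hfpos k
    nlinarith

/-- Logarithmic heights whose consecutive ratios are asymptotically `C` at multiples of `n`
and `g` elsewhere. -/
def logHeight (n : ℕ) (g C B : ℝ) : ℕ → ℝ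
  | 0 => 0
  | k + 1 => (if n ∣ k then C else g) * logHeight n g C B k + B * (k + 1)

section logHeight

variable {n : ℕ} {g C B : ℝ}

theorem logHeight_lower (hg : 1 ≤ g) (hC : g ≤ C) (hB : 0 ≤ B) (k : ℕ) :
    B * (k * (k + 1) / 2) ≤ logHeight n g C B k := by
  induction k with
  | zero => simp [logHeight]
  | succ k ih =>
    have h0 : 0 ≤ logHeight n g C B k := le_trans (by positivity) ih
    rw [logHeight]
    have h1 : logHeight n g C B k ≤ (if n ∣ k then C else g) * logHeight n g C B k := by
      split_ifs <;> nlinarith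
    push_cast
    linarith

theorem logHeight_nonneg (hg : 1 ≤ g) (hC : g ≤ C) (hB : 0 ≤ B) (k : ℕ) :
    0 ≤ logHeight n g C B k :=
  le_trans (by positivity) (logHeight_lower hg hC hB k)

theorem mul_logHeight_add_le (hg : 1 ≤ g) (hC : g ≤ C) (hB : 0 ≤ B) (k : ℕ) :
    g * logHeight n g C B k + B * (k + 1) ≤ logHeight n g C B (k + 1) := by
  have h0 := logHeight_nonneg (n := n) hg hC hB k
  rw [logHeight]
  split_ifs
  · nlinarith
  · exact le_rfl

theorem logHeight_add_le (hg : 1 ≤ g) (hC : g ≤ C) (hB : 0 ≤ B) (k : ℕ) :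
    logHeight n g C B k + B * (k + 1) ≤ logHeight n g C B (k + 1) := by
  have h0 := logHeight_nonneg (n := n) hg hC hB k
  have h1 := mul_logHeight_add_le (n := n) hg hC hB k
  nlinarith

theorem logHeight_monotone (hg : 1 ≤ g) (hC : g ≤ C) (hB : 0 ≤ B) :
    Monotone (logHeight n g C B) :=
  monotone_nat_of_le_succ fun k =>
    le_trans (le_add_of_nonneg_right (by positivity)) (logHeight_add_le hg hC hB k)

theorem tendsto_logHeight (hg : 1 ≤ g) (hC : g ≤ C) (hB : 0 < B) :
    Filter.Tendsto (logHeight n g C B) Filter.atTop Filter.atTop := by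
  have h : Filter.Tendsto (fun k : ℕ => B / 2 * (k : ℝ)) Filter.atTop Filter.atTop :=
    tendsto_natCast_atTop_atTop.const_mul_atTop (by positivity)
  refine Filter.tendsto_atTop_mono (fun k => ?_) h
  refine le_trans ?_ (logHeight_lower hg hC hB.le k)
  have hk : (0 : ℝ) ≤ k := Nat.cast_nonneg k
  have : (0 : ℝ) ≤ B * (k * k) := by positivity
  linarith

theorem sum_pow_mul_logHeight_le (hg : 1 ≤ g) (hC : g ≤ C) (hB : 0 ≤ B) (k : ℕ) :
    (∑ i ∈ Finset.range n, g ^ i) * logHeight n g C B (k + 1) ≤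
      ∑ i ∈ Finset.range n, logHeight n g C B (k + 1 + i) := by
  rw [Finset.sum_mul]
  refine Finset.sum_le_sum fun i hi => ?_
  clear hi
  induction i with
  | zero => simp
  | succ i ih =>
    have h1 := mul_logHeight_add_le (n := n) hg hC hB (k + 1 + i)
    have h2 : (0 : ℝ) ≤ B * ((k + 1 + i : ℕ) + 1) := by positivity
    have h3 := mul_le_mul_of_nonneg_left ih (by linarith : 0 ≤ g)
    rw [pow_succ']
    have h4 : k + 1 + (i + 1) = k + 1 + i + 1 := by ring
    rw [h4]
    linarith

theorem sum_pow_mul_logHeight_le_of_dvd (hg : 1 ≤ g) (hC : g ≤ C) (hB : 0 ≤ B) {k : ℕ}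
    (hk : n ∣ k) :
    C * (∑ i ∈ Finset.range n, g ^ i) * logHeight n g C B k ≤
      ∑ i ∈ Finset.range n, logHeight n g C B (k + 1 + i) := by
  refine le_trans ?_ (sum_pow_mul_logHeight_le hg hC hB k)
  rw [logHeight, if_pos hk]
  have h1 : 0 ≤ ∑ i ∈ Finset.range n, g ^ i := Finset.sum_nonneg fun i _ => by positivity
  have h2 : 0 ≤ B * ((k : ℝ) + 1) := by positivity
  have h3 := mul_nonneg h1 h2
  linarith

theorem eventually_logHeight_succ_le (hg : 1 ≤ g) (hC : g ≤ C) (hB : 0 ≤ B) {η : ℝ} (hη : 0 < η) :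
    ∃ K : ℕ, ∀ k ≥ K,
      logHeight n g C B (k + 1) ≤ ((if n ∣ k then C else g) + η) * logHeight n g C B k := by
  obtain ⟨K, hK⟩ := exists_nat_ge (2 / η)
  refine ⟨K, fun k hk => ?_⟩
  rw [logHeight, add_mul]
  have h1 : 2 / η ≤ k := hK.trans (by exact_mod_cast hk)
  rw [div_le_iff₀ hη] at h1
  have h2 := mul_le_mul_of_nonneg_left (logHeight_lower (n := n) hg hC hB k) hη.le
  have h3 : 0 ≤ B * ((k : ℝ) + 1) := by positivity
  nlinarith

theorem eventually_sum_logHeight_le_of_dvd (hg : 1 ≤ g) (hC : g ≤ C) (hB : 0 ≤ B) {η : ℝ}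
    (hη : 0 < η) : ∃ K : ℕ, ∀ k ≥ K, n ∣ k →
      ∑ i ∈ Finset.range n, logHeight n g C B (k + 1 + i) ≤
        (∑ i ∈ Finset.range n, (g + η) ^ i) * logHeight n g C B (k + 1) := by
  obtain ⟨K, hK⟩ := eventually_logHeight_succ_le (n := n) hg hC hB hη
  refine ⟨K, fun k hk hkn => ?_⟩
  rw [Finset.sum_mul]
  have key : ∀ i, i < n →
      logHeight n g C B (k + 1 + i) ≤ (g + η) ^ i * logHeight n g C B (k + 1) := by
    intro i
    induction i with
    | zero => simp
    | succ i ih =>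
      intro hi
      have h1 := hK (k + 1 + i) (by omega)
      have hnd : ¬ n ∣ k + 1 + i := fun h => by
        rw [add_assoc] at h
        have := Nat.le_of_dvd (by omega) ((Nat.dvd_add_right hkn).1 h)
        omega
      rw [if_neg hnd] at h1
      rw [show k + 1 + (i + 1) = k + 1 + i + 1 by ring, pow_succ', mul_assoc]
      exact h1.trans (mul_le_mul_of_nonneg_left (ih (by omega)) (by linarith))
  exact Finset.sum_le_sum fun i hi => key i (Finset.mem_range.1 hi)

theorem eventually_sum_logHeight_le (hg : 1 ≤ g) (hC : g ≤ C) (hB : 0 ≤ B) {η : ℝ}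
    (hη : 0 < η) : ∃ K : ℕ, ∀ k ≥ K,
      ∑ i ∈ Finset.range n, logHeight n g C B (k + 1 + i) ≤
        (C + η) * (∑ i ∈ Finset.range n, (g + η) ^ i) * logHeight n g C B k := by
  obtain ⟨K, hK⟩ := eventually_logHeight_succ_le (n := n) hg hC hB hη
  refine ⟨K, fun k hk => ?_⟩
  rw [Finset.mul_sum, Finset.sum_mul]
  have h0 := logHeight_nonneg (n := n) hg hC hB k
  have key : ∀ i, i ≤ n → logHeight n g C B (k + i) ≤ (g + η) ^ i * logHeight n g C B k ∨
      ((∃ j < i, n ∣ k + j) ∧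
        logHeight n g C B (k + i) ≤ (C + η) * (g + η) ^ (i - 1) * logHeight n g C B k) := by
    intro i
    induction i with
    | zero => simp
    | succ i ih =>
      intro hi
      have h1 := hK (k + i) (by omega)
      rw [← add_assoc]
      rcases ih (by omega) with h2 | ⟨⟨j, hj, hjn⟩, h2⟩
      · by_cases hd : n ∣ k + i
        · right
          refine ⟨⟨i, Nat.lt_succ_self i, hd⟩, h1.trans ?_⟩
          rw [if_pos hd, Nat.add_sub_cancel, mul_assoc]
          exact mul_le_mul_of_nonneg_left h2 (by linarith)
        · left
          refine h1.trans ?_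
          rw [if_neg hd, pow_succ', mul_assoc]
          exact mul_le_mul_of_nonneg_left h2 (by linarith)
      · right
        have hd : ¬ n ∣ k + i := fun h => by
          have h3 := Nat.dvd_sub h hjn
          have := Nat.le_of_dvd (by omega) h3
          omega
        refine ⟨⟨j, by omega, hjn⟩, h1.trans ?_⟩
        rw [if_neg hd, Nat.add_sub_cancel]
        have h3 := mul_le_mul_of_nonneg_left h2 (by linarith : 0 ≤ g + η)
        refine h3.trans (le_of_eq ?_)
        obtain ⟨m, rfl⟩ : ∃ m, i = m + 1 := ⟨i - 1, by omega⟩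
        rw [Nat.add_sub_cancel, pow_succ']
        ring
  refine Finset.sum_le_sum fun i hi => ?_
  have hi' := Finset.mem_range.1 hi
  rw [show k + 1 + i = k + (i + 1) by ring]
  rcases key (i + 1) hi' with h | ⟨-, h⟩
  · refine h.trans (mul_le_mul_of_nonneg_right ?_ h0)
    rw [pow_succ']
    exact mul_le_mul_of_nonneg_right (by linarith) (pow_nonneg (by linarith) _)
  · exact h

end logHeight

/-- Integer heights close to prescribed real ones that satisfy a recurrence of the form
`X (k + n + 1) = a k * X (k + 1)`. -/
theorem exists_natHeights {n : ℕ} (hn : 0 < n) {x : ℕ → ℝ} (hx0 : ∀ k, 0 ≤ x k)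
    (hx : ∀ k : ℕ, x k + 32 * n * (k + 1) ≤ x (k + 1)) :
    ∃ a X : ℕ → ℕ, (∀ k, 16 * n * 2 ^ k ≤ a k) ∧ X 0 = 0 ∧ (∀ i < n, X (i + 1) = 1) ∧
      (∀ k, X (k + n + 1) = a k * X (k + 1)) ∧ Monotone X ∧
      (∀ k, (X k : ℝ) ≤ 2 * Real.exp (x k)) ∧ ∀ k > n, Real.exp (x k) ≤ X k := by
  have hn' : (1 : ℝ) ≤ n := by exact_mod_cast hn
  have hmono : Monotone x := monotone_nat_of_le_succ fun k =>
    le_trans (le_add_of_nonneg_right (by positivity)) (hx k)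
  have hexp : ∀ k : ℕ, 32 * n * 2 ^ k * Real.exp (x (k + 1)) ≤ Real.exp (x (k + n + 1)) := by
    intro k
    have h1 : x (k + 1) + 32 * n * (k + 1) ≤ x (k + n + 1) := by
      have h2 := hx (k + 1)
      have h3 : x (k + 1 + 1) ≤ x (k + n + 1) := hmono (by omega)
      push_cast at h2
      nlinarith
    have h4 : (32 * n * 2 ^ k : ℝ) ≤ Real.exp (32 * n * (k + 1)) := by
      rw [mul_add, mul_one, add_comm, Real.exp_add]
      refine mul_le_mul ((lt_add_one _).le.trans (Real.add_one_le_exp _)) ?_ (by positivity)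
        (Real.exp_pos _).le
      have h5 : (2 : ℝ) ≤ Real.exp 1 := by
        have := Real.add_one_le_exp (1 : ℝ)
        linarith
      calc (2 : ℝ) ^ k ≤ Real.exp 1 ^ k := pow_le_pow_left₀ (by norm_num) h5 k
        _ = Real.exp k := by rw [← Real.exp_nat_mul, mul_one]
        _ ≤ _ := by
          apply Real.exp_le_exp.2
          have : (0 : ℝ) ≤ k := Nat.cast_nonneg k
          nlinarith
    calc _ ≤ Real.exp (32 * n * (k + 1)) * Real.exp (x (k + 1)) :=
          mul_le_mul_of_nonneg_right h4 (Real.exp_pos _).le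
      _ = Real.exp (x (k + 1) + 32 * n * (k + 1)) := by rw [Real.exp_add, mul_comm]
      _ ≤ _ := Real.exp_le_exp.2 h1
  have hexp2 : ∀ k : ℕ, 2 * Real.exp (x k) ≤ Real.exp (x (k + 1)) := by
    intro k
    have h1 : x k + 1 ≤ x (k + 1) := by
      have : (0 : ℝ) ≤ k := Nat.cast_nonneg k
      nlinarith [hx k]
    refine le_trans ?_ (Real.exp_le_exp.2 h1)
    rw [Real.exp_add, mul_comm]
    refine mul_le_mul_of_nonneg_left ?_ (Real.exp_pos _).le
    have := Real.add_one_le_exp (1 : ℝ)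
    linarith
  obtain ⟨X, hX0, hX⟩ := exists_recurrence hn (fun i => if i = 0 then 0 else 1)
    (fun k _ v => ⌈Real.exp (x (k + n + 1)) / (v : ℕ)⌉₊ * v)
  have hXpos : ∀ k, 0 < k → 0 < X k := by
    refine recurrence_induction hn (fun i hi h => ?_) fun k _ h _ => ?_
    · rw [hX0 i hi, if_neg h.ne']
      exact one_pos
    · rw [hX]
      have h1 := h (Nat.succ_pos k)
      have h2 : (0 : ℝ) < X (k + 1) := by exact_mod_cast h1
      exact Nat.mul_pos (Nat.ceil_pos.2 (div_pos (Real.exp_pos _) h2)) h1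
  have hle : ∀ k, (X k : ℝ) ≤ 2 * Real.exp (x k) := by
    refine recurrence_induction hn (fun i hi => ?_) fun k _ h => ?_
    · have h1 := Real.one_le_exp (hx0 i)
      rw [hX0 i hi]
      split_ifs <;> push_cast <;> linarith
    · have h2 : (0 : ℝ) < X (k + 1) := by exact_mod_cast hXpos (k + 1) (Nat.succ_pos k)
      have h3 := (Nat.ceil_lt_add_one (div_pos (Real.exp_pos (x (k + n + 1))) h2).le).le
      have h4 := mul_le_mul_of_nonneg_right h3 h2.le
      rw [add_mul, div_mul_cancel₀ _ h2.ne', one_mul] at h4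
      rw [hX]
      push_cast
      have h5 := hexp2 (k + 1)
      have h6 := Real.exp_le_exp.2 (hmono (show k + 1 + 1 ≤ k + n + 1 by omega))
      linarith
  have hge : ∀ k > n, Real.exp (x k) ≤ X k := by
    intro k hk
    obtain ⟨m, rfl⟩ : ∃ m, k = m + n + 1 := ⟨k - n - 1, by omega⟩
    have h2 : (0 : ℝ) < X (m + 1) := by exact_mod_cast hXpos (m + 1) (Nat.succ_pos m)
    rw [hX]
    push_cast
    rw [← div_le_iff₀ h2]
    exact Nat.le_ceil _
  refine ⟨fun k => ⌈Real.exp (x (k + n + 1)) / X (k + 1)⌉₊, X, fun k => ?_, ?_, fun i hi => ?_,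
    hX, monotone_nat_of_le_succ fun k => ?_, hle, hge⟩
  · have h2 : (0 : ℝ) < X (k + 1) := by exact_mod_cast hXpos (k + 1) (Nat.succ_pos k)
    have h3 : (16 * n * 2 ^ k : ℝ) ≤ Real.exp (x (k + n + 1)) / X (k + 1) := by
      rw [le_div_iff₀ h2]
      refine le_trans ?_ (hexp k)
      have h4 := mul_le_mul_of_nonneg_left (hle (k + 1)) (by positivity : (0 : ℝ) ≤ 16 * n * 2 ^ k)
      linarith
    have h4 := h3.trans (Nat.le_ceil _)
    exact_mod_cast h4
  · rw [hX0 0 (Nat.zero_le n), if_pos rfl]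
  · rw [hX0 (i + 1) hi, if_neg (Nat.succ_ne_zero i)]
  · rcases Nat.lt_or_ge k n with h | h
    · rw [hX0 k h.le, hX0 (k + 1) h, if_neg (Nat.succ_ne_zero k)]
      split_ifs <;> omega
    · have h1 := (hle k).trans ((hexp2 k).trans (hge (k + 1) (by omega)))
      exact_mod_cast h1

theorem nint_le_abs_add_intCast (y : ℝ) (p : ℤ) : nint y ≤ |y + p| := by
  have h := round_le y (-p)
  rw [Int.cast_neg, sub_neg_eq_add] at h
  exact h

theorem phi_le {n : ℕ} (hn : 0 < n) {θ : Fin n → ℝ} {t : ℝ} {q : Fin n → ℤ} (hq : q ≠ 0)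
    (hqt : ∀ j, |(q j : ℝ)| ≤ t) (p : ℤ) : phi θ t ≤ |∑ j, (q j : ℝ) * θ j + p| := by
  have : Nonempty (Fin n) := ⟨⟨0, hn⟩⟩
  refine le_trans (csInf_le ⟨0, ?_⟩ ⟨q, hq, ciSup_le hqt, rfl⟩) (nint_le_abs_add_intCast _ p)
  rintro v ⟨_, _, _, rfl⟩
  exact abs_nonneg _

theorem le_phi {n : ℕ} (hn : 0 < n) {θ : Fin n → ℝ} {t b : ℝ} (ht : 1 ≤ t)
    (h : ∀ (q : Fin n → ℤ) (p : ℤ), q ≠ 0 → (∀ j, |(q j : ℝ)| ≤ t) →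
      b ≤ |∑ j, (q j : ℝ) * θ j + p|) : b ≤ phi θ t := by
  have : Nonempty (Fin n) := ⟨⟨0, hn⟩⟩
  refine le_csInf ⟨_, fun _ => 1, fun h0 => one_ne_zero (congrFun h0 ⟨0, hn⟩),
    ciSup_le fun j => by simpa using ht, rfl⟩ ?_
  rintro v ⟨q, hq, hqt, rfl⟩
  have h1 := h q (-round (∑ j, (q j : ℝ) * θ j)) hq fun j =>
    (le_ciSup (f := fun j => |(q j : ℝ)|) (Set.finite_range _).bddAbove j).trans hqt
  rw [Int.cast_neg, ← sub_eq_add_neg] at h1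
  exact h1

theorem linearIndependent_of_phi_pos {n : ℕ} (hn : 0 < n) {θ : Fin n → ℝ}
    (h : ∀ᶠ t in Filter.atTop, 0 < phi θ t) :
    LinearIndependent ℚ (Fin.cons (1 : ℝ) θ : Fin (n + 1) → ℝ) := by
  rw [← LinearIndependent.iff_fractionRing ℤ ℚ, Fintype.linearIndependent_iff]
  intro c hc
  rw [Fin.sum_univ_succ] at hc
  simp only [Fin.cons_zero, Fin.cons_succ, zsmul_eq_mul, mul_one] at hc
  have hq : (fun j : Fin n => c j.succ) = 0 := by
    by_contra hq
    obtain ⟨t, ht, htq⟩ := (h.and ((Filter.eventually_all (ι := Fin n)).2 fun j =>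
      Filter.eventually_ge_atTop |((c j.succ : ℤ) : ℝ)|)).exists
    have h1 := phi_le hn hq htq (c 0) (θ := θ)
    rw [add_comm, hc, abs_zero] at h1
    exact absurd ht h1.not_gt
  have h0 : c 0 = 0 := by
    have h1 : ∀ j : Fin n, c j.succ = 0 := fun j => congrFun hq j
    simpa [h1] using hc
  exact Fin.cases h0 fun j => congrFun hq j

theorem exists_nat_mem_Ico_succ {u : ℕ → ℝ} (hu : Filter.Tendsto u Filter.atTop Filter.atTop)
    {K : ℕ} {t : ℝ} (ht : u K ≤ t) : ∃ k ≥ K, u k ≤ t ∧ t < u (k + 1) := by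
  obtain ⟨m, hm, hmt⟩ : ∃ m ≥ K, t < u m :=
    ((Filter.eventually_ge_atTop K).and (hu.eventually_gt_atTop t)).exists
  by_contra! h
  have : ∀ i, u (K + i) ≤ t := by
    intro i
    induction i with
    | zero => exact ht
    | succ i ih => exact h (K + i) (Nat.le_add_right _ _) ih
  have h1 := this (m - K)
  rw [Nat.add_sub_cancel' hm] at h1
  linarith

section exponents

variable {n : ℕ} {θ : Fin n → ℝ} {x S : ℕ → ℝ} {c w : ℝ} {K : ℕ}

theorem exp_mul_rpow (b y w : ℝ) (hb : 0 < b) :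
    (b * Real.exp y) ^ w = b ^ w * Real.exp (w * y) := by
  rw [Real.mul_rpow hb.le (Real.exp_pos y).le, ← Real.exp_mul, mul_comm y]

theorem rpow_mul_phi_le (hw : 0 ≤ w)
    (hU : ∀ k ≥ K, ∀ t, 4 * Real.exp (x k) ≤ t → phi θ t ≤ Real.exp (-S k)) {k : ℕ} (hk : K ≤ k)
    {t y : ℝ} (ht : 4 * Real.exp (x k) ≤ t) (hty : t ≤ 4 * Real.exp y) (hS : w * y ≤ S k) :
    t ^ w * phi θ t ≤ 4 ^ w := by
  have ht0 : 0 ≤ t := le_trans (by positivity) ht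
  calc t ^ w * phi θ t ≤ t ^ w * Real.exp (-S k) :=
        mul_le_mul_of_nonneg_left (hU k hk t ht) (Real.rpow_nonneg ht0 w)
    _ ≤ (4 * Real.exp y) ^ w * Real.exp (-S k) :=
        mul_le_mul_of_nonneg_right (Real.rpow_le_rpow ht0 hty hw) (Real.exp_pos _).le
    _ = 4 ^ w * Real.exp (w * y - S k) := by
        rw [exp_mul_rpow _ _ _ (by norm_num), mul_assoc, ← Real.exp_add, sub_eq_add_neg]
    _ ≤ 4 ^ w * 1 := by
        refine mul_le_mul_of_nonneg_left ?_ (by positivity)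
        exact Real.exp_le_one_iff.2 (by linarith)
    _ = _ := mul_one _

theorem le_rpow_mul_phi (hw : 0 ≤ w) (hc : 0 < c)
    (hL : ∀ k ≥ K, ∀ t, 1 ≤ t → t ≤ 1 / 2 * Real.exp (x (k + 1)) → c * Real.exp (-S k) ≤ phi θ t)
    {k : ℕ} (hk : K ≤ k) {t y w' : ℝ} (ht : t ≤ 1 / 2 * Real.exp (x (k + 1))) (ht1 : 1 ≤ t)
    (hty : 1 / 2 * Real.exp y ≤ t) (hS : S k ≤ w' * y) :
    c * (1 / 2) ^ w * Real.exp ((w - w') * y) ≤ t ^ w * phi θ t := by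
  have ht0 : 0 ≤ t := zero_le_one.trans ht1
  calc c * (1 / 2) ^ w * Real.exp ((w - w') * y)
      ≤ c * (1 / 2) ^ w * Real.exp (w * y - S k) := by
        refine mul_le_mul_of_nonneg_left (Real.exp_le_exp.2 ?_) (by positivity)
        linarith
    _ = (1 / 2 * Real.exp y) ^ w * (c * Real.exp (-S k)) := by
        rw [exp_mul_rpow _ _ _ (by norm_num), sub_eq_add_neg, Real.exp_add]
        ring
    _ ≤ t ^ w * phi θ t :=
        mul_le_mul (Real.rpow_le_rpow (by positivity) hty hw) (hL k hk t ht1 ht) (by positivity)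
          (Real.rpow_nonneg ht0 w)

theorem tendsto_const_mul_exp (hc : 0 < c) {w' : ℝ} (hw : w' < w)
    (hx : Filter.Tendsto x Filter.atTop Filter.atTop) :
    Filter.Tendsto (fun k => c * (1 / 2) ^ w * Real.exp ((w - w') * x k))
      Filter.atTop Filter.atTop :=
  (Real.tendsto_exp_atTop.comp (hx.const_mul_atTop (sub_pos.2 hw))).const_mul_atTop
    (by positivity)

theorem omegaUnif_eq (hx : Filter.Tendsto x Filter.atTop Filter.atTop) (hc : 0 < c)
    (hU : ∀ k ≥ K, ∀ t, 4 * Real.exp (x k) ≤ t → phi θ t ≤ Real.exp (-S k))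
    (hL : ∀ k ≥ K, ∀ t, 1 ≤ t → t ≤ 1 / 2 * Real.exp (x (k + 1)) → c * Real.exp (-S k) ≤ phi θ t)
    {W : ℝ} (hW : 0 ≤ W) (hSge : ∀ k, W * x (k + 1) ≤ S k)
    (hSle : ∀ w > W, ∃ w' < w, ∃ᶠ k in Filter.atTop, S k ≤ w' * x (k + 1)) :
    omegaUnif θ = ENNReal.ofReal W := by
  refine le_antisymm (sSup_le ?_) (le_sSup ⟨W, hW, rfl, ?_⟩)
  · rintro _ ⟨w, hw, rfl, hlim⟩
    refine ENNReal.ofReal_le_ofReal ?_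
    by_contra! hlt
    obtain ⟨w', hw', hfreq⟩ := hSle w hlt
    obtain ⟨M, hM, -⟩ := ENNReal.lt_iff_exists_nnreal_btwn.1 hlim
    have hev : ∀ᶠ t : ℝ in Filter.atTop, t ^ w * phi θ t < M := by
      filter_upwards [Filter.eventually_lt_of_limsup_lt hM] with t ht
      exact lt_of_not_ge fun h => absurd ht
        (not_lt.2 (by simpa using ENNReal.ofReal_le_ofReal h))
    have hx1 := hx.comp (Filter.tendsto_add_atTop_nat 1)
    have htk : Filter.Tendsto (fun k => 1 / 2 * Real.exp (x (k + 1))) Filter.atTop Filter.atTop :=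
      (Real.tendsto_exp_atTop.comp hx1).const_mul_atTop (by norm_num)
    obtain ⟨k, h1, ⟨h2, h3⟩, h4, h5⟩ := (hfreq.and_eventually (((htk.eventually hev).and
      (htk.eventually_ge_atTop 1)).and ((Filter.eventually_ge_atTop K).and
      ((tendsto_const_mul_exp hc hw' hx1).eventually_ge_atTop (M : ℝ))))).exists
    have h6 := le_rpow_mul_phi hw hc hL h4 le_rfl h3 le_rfl h1
    exact absurd h2 (not_lt.2 (le_trans h5 h6))
  · have hu : Filter.Tendsto (fun k => 4 * Real.exp (x k)) Filter.atTop Filter.atTop :=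
      (Real.tendsto_exp_atTop.comp hx).const_mul_atTop (by norm_num)
    refine lt_of_le_of_lt (Filter.limsup_le_of_le (a := ENNReal.ofReal (4 ^ W))
      (by isBoundedDefault) ?_)
      ENNReal.ofReal_lt_top
    filter_upwards [Filter.eventually_ge_atTop (4 * Real.exp (x K))] with t ht
    obtain ⟨k, hk, h1, h2⟩ := exists_nat_mem_Ico_succ hu ht
    exact ENNReal.ofReal_le_ofReal (rpow_mul_phi_le hW hU hk h1 h2.le (hSge k))

theorem omegaOrd_eq (hx : Filter.Tendsto x Filter.atTop Filter.atTop) (hc : 0 < c)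
    (hU : ∀ k ≥ K, ∀ t, 4 * Real.exp (x k) ≤ t → phi θ t ≤ Real.exp (-S k))
    (hL : ∀ k ≥ K, ∀ t, 1 ≤ t → t ≤ 1 / 2 * Real.exp (x (k + 1)) → c * Real.exp (-S k) ≤ phi θ t)
    {W : ℝ} (hW : 0 ≤ W) (hSge : ∃ᶠ k in Filter.atTop, W * x k ≤ S k)
    (hSle : ∀ w > W, ∃ w' < w, ∀ᶠ k in Filter.atTop, S k ≤ w' * x k) :
    omegaOrd θ = ENNReal.ofReal W := by
  refine le_antisymm (sSup_le ?_) (le_sSup ⟨W, hW, rfl, ?_⟩)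
  · rintro _ ⟨w, hw, rfl, hlim⟩
    refine ENNReal.ofReal_le_ofReal ?_
    by_contra! hlt
    obtain ⟨w', hw', hev⟩ := hSle w hlt
    obtain ⟨M, hM, -⟩ := ENNReal.lt_iff_exists_nnreal_btwn.1 hlim
    have hu : Filter.Tendsto (fun k => 1 / 2 * Real.exp (x k)) Filter.atTop Filter.atTop :=
      (Real.tendsto_exp_atTop.comp hx).const_mul_atTop (by norm_num)
    obtain ⟨N, hN⟩ := Filter.eventually_atTop.1 ((hev.and (hu.eventually_ge_atTop 1)).and
      ((Filter.eventually_ge_atTop K).and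
        ((tendsto_const_mul_exp hc hw' hx).eventually_ge_atTop (M : ℝ))))
    obtain ⟨t, h1, h2⟩ := ((Filter.frequently_lt_of_liminf_lt
      (by isBoundedDefault) hM).and_eventually
      (Filter.eventually_ge_atTop (1 / 2 * Real.exp (x N)))).exists
    obtain ⟨k, hk, h3, h4⟩ := exists_nat_mem_Ico_succ hu h2
    obtain ⟨⟨h5, h6⟩, h7, h8⟩ := hN k hk
    have h9 := le_rpow_mul_phi hw hc hL h7 h4.le (h6.trans h3) h3 h5
    exact absurd h1 (not_lt.2 (by simpa using ENNReal.ofReal_le_ofReal (le_trans h8 h9)))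
  · have hu : Filter.Tendsto (fun k => 4 * Real.exp (x k)) Filter.atTop Filter.atTop :=
      (Real.tendsto_exp_atTop.comp hx).const_mul_atTop (by norm_num)
    refine lt_of_le_of_lt (Filter.liminf_le_of_frequently_le (a := ENNReal.ofReal (4 ^ W)) ?_
      (by isBoundedDefault)) ENNReal.ofReal_lt_top
    refine hu.frequently ((hSge.and_eventually (Filter.eventually_ge_atTop K)).mono ?_)
    rintro k ⟨h1, h2⟩
    exact ENNReal.ofReal_le_ofReal (rpow_mul_phi_le hW hU h2 le_rfl le_rfl h1)

end exponents

theorem phi_add_natCast {n : ℕ} (θ : Fin n → ℝ) (m : ℕ) :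
    phi (fun j => θ j + m) = phi θ := by
  have h : ∀ q : Fin n → ℤ, nint (∑ j, (q j : ℝ) * (θ j + m)) = nint (∑ j, (q j : ℝ) * θ j) := by
    intro q
    have h1 : ∑ j, (q j : ℝ) * (θ j + m) = ∑ j, (q j : ℝ) * θ j + ((∑ j, q j * m : ℤ) : ℝ) := by
      push_cast
      rw [← Finset.sum_add_distrib]
      exact Finset.sum_congr rfl fun j _ => mul_add _ _ _
    rw [nint, nint, h1, round_add_intCast]
    push_cast
    rw [add_sub_add_right_eq_sub]
  funext t
  simp only [phi, h]

theorem exists_gt_of_continuous_of_lt {F : ℝ → ℝ} (hF : Continuous F) {w : ℝ} (h : F 0 < w) :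
    ∃ η > 0, F η < w := by
  obtain ⟨η, h1, h2⟩ := (((hF.tendsto 0).eventually_lt_const h).filter_mono
    nhdsWithin_le_nhds |>.and (self_mem_nhdsWithin (s := Set.Ioi (0 : ℝ)))).exists
  exact ⟨η, h2, h1⟩

theorem exists_phi_bounds {n : ℕ} (hn : 0 < n) {x : ℕ → ℝ} (hx0 : ∀ k, 0 ≤ x k)
    (hx : ∀ k : ℕ, x k + 32 * n * (k + 1) ≤ x (k + 1)) :
    ∃ θ : Fin n → ℝ,
      (∀ k ≥ n + 1, ∀ t, 4 * Real.exp (x k) ≤ t →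
        phi θ t ≤ Real.exp (-∑ i ∈ Finset.range n, x (k + 1 + i))) ∧
      ∀ k ≥ n + 1, ∀ t, 1 ≤ t → t ≤ 1 / 2 * Real.exp (x (k + 1)) →
        1 / (4 * 2 ^ n) * Real.exp (-∑ i ∈ Finset.range n, x (k + 1 + i)) ≤ phi θ t := by
  obtain ⟨a, X, ha, hX0, hX1, hX, hmono, hle, hge⟩ := exists_natHeights hn hx0 hx
  obtain ⟨θ, hup, hlow⟩ := exists_linear_form_with_heights hn ha hX0 hX1 hX hmono
  have hexp : ∀ k, Real.exp (∑ i ∈ Finset.range n, x (k + 1 + i)) =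
      ∏ i ∈ Finset.range n, Real.exp (x (k + 1 + i)) := fun k => Real.exp_sum _ _
  refine ⟨θ, fun k hk t ht => ?_, fun k hk t ht1 ht => le_phi hn ht1 fun q p hq hqt => ?_⟩
  · obtain ⟨m, rfl⟩ : ∃ m, k = m + 1 := ⟨k - 1, by omega⟩
    obtain ⟨q, p, hq, hqX, hL⟩ := hup m
    refine (phi_le hn hq (fun j => (hqX j).trans ?_) p).trans (hL.trans ?_)
    · linarith [hle (m + 1)]
    · rw [Real.exp_neg, hexp]
      exact inv_anti₀ (Finset.prod_pos fun i _ => Real.exp_pos _)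
        (Finset.prod_le_prod (fun i _ => (Real.exp_pos _).le) fun i _ => hge _ (by omega))
  · refine le_trans ?_ (hlow k q p hq fun j => (hqt j).trans (ht.trans ?_))
    · have h1 : ∏ i ∈ Finset.range n, (X (k + 1 + i) : ℝ) ≤
          2 ^ n * Real.exp (∑ i ∈ Finset.range n, x (k + 1 + i)) := by
        rw [hexp]
        refine (Finset.prod_le_prod (fun i _ => Nat.cast_nonneg _) fun i _ => hle _).trans ?_
        rw [Finset.prod_mul_distrib, Finset.prod_const, Finset.card_range]
      have h2 : 0 < ∏ i ∈ Finset.range n, (X (k + 1 + i) : ℝ) :=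
        Finset.prod_pos fun i _ => (Real.exp_pos _).trans_le (hge _ (by omega))
      have h3 := inv_anti₀ h2 h1
      rw [mul_inv, ← Real.exp_neg] at h3
      refine le_trans (le_of_eq ?_) (div_le_div_of_nonneg_right h3 (by norm_num : (0 : ℝ) ≤ 4))
      field_simp
    · linarith [hge (k + 1) (by omega)]

theorem exists_omegaUnif_omegaOrd_eq {n : ℕ} (hn : 0 < n) {g C : ℝ} (hg : 1 ≤ g) (hC : g ≤ C) :
    ∃ θ : Fin n → ℝ, (∀ᶠ t in Filter.atTop, 0 < phi θ t) ∧
      omegaUnif θ = ENNReal.ofReal (∑ i ∈ Finset.range n, g ^ i) ∧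
      omegaOrd θ = ENNReal.ofReal (C * ∑ i ∈ Finset.range n, g ^ i) := by
  have hB : (0 : ℝ) < 32 * n := by positivity
  set x := logHeight n g C (32 * n) with hxdef
  have htend : Filter.Tendsto x Filter.atTop Filter.atTop := tendsto_logHeight hg hC hB
  have hx0 : ∀ k, 0 ≤ x k := logHeight_nonneg hg hC hB.le
  obtain ⟨θ, hU, hL⟩ := exists_phi_bounds hn hx0 (logHeight_add_le hg hC hB.le)
  have hc : (0 : ℝ) < 1 / (4 * 2 ^ n) := by positivity
  have hW : 0 ≤ ∑ i ∈ Finset.range n, g ^ i := Finset.sum_nonneg fun i _ => by positivity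
  have hdvd : ∃ᶠ k in Filter.atTop, n ∣ k :=
    Filter.frequently_atTop.2 fun a => ⟨n * a, Nat.le_mul_of_pos_left a hn, dvd_mul_right n a⟩
  refine ⟨θ, ?_, ?_, ?_⟩
  · have hu : Filter.Tendsto (fun k => 1 / 2 * Real.exp (x (k + 1))) Filter.atTop Filter.atTop :=
      (Real.tendsto_exp_atTop.comp
        (htend.comp (Filter.tendsto_add_atTop_nat 1))).const_mul_atTop (by norm_num)
    filter_upwards [Filter.eventually_ge_atTop 1] with t ht
    obtain ⟨k, hk, hkt⟩ := ((Filter.eventually_ge_atTop (n + 1)).and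
      (hu.eventually_ge_atTop t)).exists
    exact lt_of_lt_of_le (by positivity) (hL k hk t ht hkt)
  · refine omegaUnif_eq htend hc hU hL hW (sum_pow_mul_logHeight_le hg hC hB.le) fun w hw => ?_
    obtain ⟨η, hη, hlt⟩ := exists_gt_of_continuous_of_lt
      (F := fun η => ∑ i ∈ Finset.range n, (g + η) ^ i) (by fun_prop) (by simpa using hw)
    obtain ⟨K, hK⟩ := eventually_sum_logHeight_le_of_dvd (n := n) hg hC hB.le hη
    exact ⟨_, hlt, (hdvd.and_eventually (Filter.eventually_ge_atTop K)).mono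
      fun k hk => hK k hk.2 hk.1⟩
  · refine omegaOrd_eq htend hc hU hL (mul_nonneg (by linarith) hW)
      (hdvd.mono fun k hk => sum_pow_mul_logHeight_le_of_dvd hg hC hB.le hk) fun w hw => ?_
    obtain ⟨η, hη, hlt⟩ := exists_gt_of_continuous_of_lt
      (F := fun η => (C + η) * ∑ i ∈ Finset.range n, (g + η) ^ i) (by fun_prop) (by simpa using hw)
    obtain ⟨K, hK⟩ := eventually_sum_logHeight_le (n := n) hg hC hB.le hη
    exact ⟨_, hlt, Filter.eventually_atTop.2 ⟨K, hK⟩⟩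

theorem one_le_of_le_sum_pow {n : ℕ} (hn : 2 ≤ n) {g : ℝ} (hg : 0 < g)
    (h : (n : ℝ) ≤ ∑ i ∈ Finset.range n, g ^ i) : 1 ≤ g := by
  by_contra! hlt
  have h1 : ∑ i ∈ Finset.range n, g ^ i < ∑ _i ∈ Finset.range n, (1 : ℝ) :=
    Finset.sum_lt_sum (fun i _ => pow_le_one₀ hg.le hlt.le)
      ⟨1, Finset.mem_range.2 hn, by simpa using hlt⟩
  rw [Finset.sum_const, Finset.card_range, nsmul_eq_mul, mul_one] at h1
  linarith

/-- For `n ≥ 2`, `ω̂ ≥ n` and `C ≥ G*(n, ω̂)` (the unique positive root `g` of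
`R*_{n,ω̂}`), the set of `θ` with `ℚ`-linearly independent coordinates with `1`,
`ω̂(θ) = ω̂` and `ω(θ) = C·ω̂` is infinite. -/
theorem statement2 {n : ℕ} (hn : 2 ≤ n) (ωh : ℝ) (hωh : (n : ℝ) ≤ ωh)
    (C g : ℝ) (hg : 0 < g) (hgroot : Rstar n ωh g = 0) (hC : g ≤ C) :
    {θ : Fin n → ℝ | LinearIndependent ℚ (Fin.cons (1 : ℝ) θ : Fin (n + 1) → ℝ) ∧
      omegaUnif θ = ENNReal.ofReal ωh ∧
      omegaOrd θ = ENNReal.ofReal (C * ωh)}.Infinite := by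
  have hsum : ∑ i ∈ Finset.range n, g ^ i = ωh := sub_eq_zero.1 hgroot
  have hg1 : 1 ≤ g := one_le_of_le_sum_pow hn hg (by rwa [hsum])
  obtain ⟨θ, hpos, hunif, hord⟩ := exists_omegaUnif_omegaOrd_eq (n := n) (by omega) hg1 hC
  rw [hsum] at hunif hord
  refine Set.infinite_of_injective_forall_mem (f := fun (m : ℕ) (j : Fin n) => θ j + m)
    (fun m m' h => ?_) fun m => ⟨?_, ?_, ?_⟩
  · have h1 := congrFun h ⟨0, by omega⟩
    exact_mod_cast add_left_cancel h1
  · exact linearIndependent_of_phi_pos (by omega) (by rwa [phi_add_natCast])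
  · rwa [omegaUnif, phi_add_natCast]
  · rwa [omegaOrd, phi_add_natCast]

end
end
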